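/- arXiv:quant-ph/0404180 — 4 statements merged into one kernel-verified Lean document; each statement's English description precedes it below -/
import Mathlib

section
/- For an invertible complex antisymmetric 2n×2n matrix M and Grassmann variables η_1,…,η_{2n} commuting as additional generators, ∫ Dθ exp(ηᵀθ + (i/2) θᵀMθ) = iⁿ Pf(M) · exp(-(i/2) ηᵀ M⁻¹ η) in the Grassmann algebra G_{4n}. -/
open scoped BigOperators
open Matrix

/-- Pfaffian of a `2n × 2n` matrix via the permutation-sum formula
`Pf(N) = (1/(2^n n!)) ∑_{σ} sgn(σ) N_{σ(1)σ(2)} ⋯ N_{σ(2n-1)σ(2n)}`. -/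
noncomputable def pfaffian {R : Type*} [Field R] {n : ℕ} (N : Matrix (Fin (2*n)) (Fin (2*n)) R) : R :=
  ((2:R)^n * (n.factorial : R))⁻¹ *
    ∑ σ : Equiv.Perm (Fin (2*n)), ((Equiv.Perm.sign σ : ℤ) : R) *
      ∏ j : Fin n, N (σ ⟨2*j.val, by have := j.isLt; omega⟩) (σ ⟨2*j.val+1, by have := j.isLt; omega⟩)
/-- Grassmann algebra on variables indexed by `ι`. -/
abbrev GA (ι : Type*) := ExteriorAlgebra ℂ (ι → ℂ)

/-- The Grassmann generator `θ_a`. -/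
noncomputable def θv {ι : Type*} [DecidableEq ι] (a : ι) : GA ι :=
  ExteriorAlgebra.ι ℂ (Pi.single a 1)

/-- The partial derivative `∂/∂θ_a` (left interior product / Berezin integral `∫ dθ_a`). -/
noncomputable def pderiv (ι : Type*) [DecidableEq ι] (a : ι) : GA ι →ₗ[ℂ] GA ι :=
  CliffordAlgebra.contractLeft (Q := (0 : QuadraticForm ℂ (ι → ℂ))) (LinearMap.proj a)

/-- Berezin integration along a list of variables (first element integrated first). -/
noncomputable def berezinAlong {ι : Type*} [DecidableEq ι] (l : List ι) : GA ι →ₗ[ℂ] GA ι :=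
  l.foldl (fun acc a => pderiv ι a ∘ₗ acc) LinearMap.id

/-- Full Berezin integral `∫ Dθ = ∫dθ_n ⋯ ∫dθ_1`, normalized so that
`∫ Dθ θ_1⋯θ_n = 1` (the result of the operator is the coefficient of `θ_1⋯θ_n`,
viewed as a scalar inside the algebra). -/
noncomputable def berezin (n : ℕ) : GA (Fin n) →ₗ[ℂ] GA (Fin n) :=
  berezinAlong (List.ofFn (id : Fin n → Fin n))

/-- Exponential defined by its (finite, since arguments are nilpotent) Taylor series,
truncated after `N` terms. -/
noncomputable def gexp {A : Type*} [Ring A] [Algebra ℂ A] (N : ℕ) (x : A) : A :=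
  ∑ k ∈ Finset.range N, ((k.factorial : ℂ))⁻¹ • x ^ k

/-- The quadratic form `θᵀ M θ = ∑_{a,b} M_{ab} θ_a θ_b`. -/
noncomputable def quadform {n : ℕ} (M : Matrix (Fin n) (Fin n) ℂ) : GA (Fin n) :=
  ∑ a, ∑ b, M a b • (θv a * θv b)

section helpers

set_option linter.unusedSectionVars false

variable {κ μ : Type*} [DecidableEq κ] [DecidableEq μ]

theorem foldl_berezin (l : List κ) (acc : GA κ →ₗ[ℂ] GA κ) (x : GA κ) :
    l.foldl (fun acc a => pderiv κ a ∘ₗ acc) acc x = berezinAlong l (acc x) := by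
  induction l generalizing acc x with
  | nil => simp [berezinAlong]
  | cons a l ih =>
    have h : berezinAlong (a :: l) (acc x) =
        (l.foldl (fun acc a => pderiv κ a ∘ₗ acc) (pderiv κ a ∘ₗ LinearMap.id)) (acc x) := rfl
    rw [List.foldl_cons, ih, h, ih]
    simp

theorem berezinAlong_nil (x : GA κ) : berezinAlong ([] : List κ) x = x := by
  simp [berezinAlong]

theorem berezinAlong_cons (a : κ) (l : List κ) (x : GA κ) :
    berezinAlong (a :: l) x = berezinAlong l (pderiv κ a x) := by
  rw [berezinAlong, List.foldl_cons, foldl_berezin]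
  simp

theorem pderiv_ι_mul (a : κ) (v : κ → ℂ) (x : GA κ) :
    pderiv κ a (ExteriorAlgebra.ι ℂ v * x) = v a • x - ExteriorAlgebra.ι ℂ v * pderiv κ a x :=
  CliffordAlgebra.contractLeft_ι_mul _ v x

theorem pderiv_algebraMap (a : κ) (r : ℂ) : pderiv κ a (algebraMap ℂ (GA κ) r) = 0 :=
  CliffordAlgebra.contractLeft_algebraMap _ _ r

theorem pderiv_one (a : κ) : pderiv κ a 1 = 0 :=
  CliffordAlgebra.contractLeft_one _ _

theorem GA_induction {P : GA κ → Prop} (hC : ∀ r : ℂ, P (algebraMap _ _ r))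
    (hadd : ∀ x y, P x → P y → P (x + y))
    (hmul : ∀ x v, P x → P (ExteriorAlgebra.ι ℂ v * x)) : ∀ x, P x :=
  fun x => CliffordAlgebra.left_induction (Q := (0 : QuadraticForm ℂ (κ → ℂ))) (P := P)
    hC hadd hmul x

/-- Contraction intertwines algebra maps induced by linear maps. -/
theorem pderiv_map (f : (κ → ℂ) →ₗ[ℂ] (μ → ℂ)) (a : κ) (b : μ)
    (h : ∀ v, f v b = v a) (x : GA κ) :
    pderiv μ b (ExteriorAlgebra.map f x) = ExteriorAlgebra.map f (pderiv κ a x) := by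
  induction x using GA_induction with
  | hC r => rw [AlgHom.commutes, pderiv_algebraMap, pderiv_algebraMap, map_zero]
  | hadd x y hx hy => simp only [map_add, hx, hy]
  | hmul x v hx =>
    rw [map_mul, ExteriorAlgebra.map_apply_ι, pderiv_ι_mul, pderiv_ι_mul, map_sub, map_mul,
      ExteriorAlgebra.map_apply_ι, hx, h, map_smul]

theorem berezinAlong_map (f : (κ → ℂ) →ₗ[ℂ] (μ → ℂ)) (g : κ → μ)
    (h : ∀ v a, f v (g a) = v a) (l : List κ) (x : GA κ) :
    berezinAlong (l.map g) (ExteriorAlgebra.map f x) =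
      ExteriorAlgebra.map f (berezinAlong l x) := by
  induction l generalizing x with
  | nil => simp [berezinAlong_nil]
  | cons a l ih =>
    rw [List.map_cons, berezinAlong_cons, berezinAlong_cons, pderiv_map f a (g a) (fun v => h v a),
      ih]

theorem berezinAlong_map_self (f : (κ → ℂ) →ₗ[ℂ] (κ → ℂ)) (l : List κ)
    (h : ∀ v, ∀ a ∈ l, f v a = v a) (x : GA κ) :
    berezinAlong l (ExteriorAlgebra.map f x) =
      ExteriorAlgebra.map f (berezinAlong l x) := by
  induction l generalizing x with
  | nil => simp [berezinAlong_nil]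
  | cons a l ih =>
    rw [berezinAlong_cons, berezinAlong_cons, pderiv_map f a a (fun v => h v a (by simp)),
      ih (fun v b hb => h v b (by simp [hb]))]

theorem pderiv_mul_right (a : κ) (y : GA κ) (hy : pderiv κ a y = 0) (x : GA κ) :
    pderiv κ a (x * y) = pderiv κ a x * y := by
  induction x using GA_induction with
  | hC r => rw [← Algebra.smul_def, map_smul, hy, pderiv_algebraMap]; simp
  | hadd x z hx hz => simp only [add_mul, map_add, hx, hz]
  | hmul x v hx => rw [mul_assoc, pderiv_ι_mul, pderiv_ι_mul, hx, sub_mul, smul_mul_assoc, mul_assoc]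

theorem berezinAlong_mul_right (l : List κ) (y : GA κ) (hy : ∀ a ∈ l, pderiv κ a y = 0)
    (x : GA κ) : berezinAlong l (x * y) = berezinAlong l x * y := by
  induction l generalizing x with
  | nil => simp [berezinAlong_nil]
  | cons a l ih =>
    rw [berezinAlong_cons, berezinAlong_cons, pderiv_mul_right a y (hy a (by simp)),
      ih (fun b hb => hy b (by simp [hb]))]

theorem pderiv_pow (a : κ) (y : GA κ) (hy : pderiv κ a y = 0) (k : ℕ) :
    pderiv κ a (y ^ k) = 0 := by
  induction k with
  | zero => rw [pow_zero, pderiv_one]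
  | succ k ih => rw [pow_succ, pderiv_mul_right a y hy, ih, zero_mul]

theorem pderiv_gexp (a : κ) (y : GA κ) (hy : pderiv κ a y = 0) (N : ℕ) :
    pderiv κ a (gexp N y) = 0 := by
  rw [gexp, map_sum]
  exact Finset.sum_eq_zero fun k _ => by rw [map_smul, pderiv_pow a y hy, smul_zero]

theorem pderiv_prod (a : κ) (l : List κ) (ha : a ∉ l) :
    pderiv κ a ((l.map θv).prod) = 0 := by
  induction l with
  | nil => simp [pderiv_one]
  | cons b l ih =>
    have hab : a ≠ b := fun h => ha (by simp [h])
    rw [List.map_cons, List.prod_cons, θv, pderiv_ι_mul, ih (fun h => ha (by simp [h]))]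
    simp [hab]

theorem berezinAlong_prod (l : List κ) (hl : l.Nodup) :
    berezinAlong l ((l.map θv).prod) = (1 : GA κ) := by
  induction l with
  | nil => simp [berezinAlong_nil]
  | cons b l ih =>
    rw [List.nodup_cons] at hl
    rw [List.map_cons, List.prod_cons, berezinAlong_cons]
    nth_rewrite 1 [θv]
    rw [pderiv_ι_mul, pderiv_prod b l hl.1]
    simpa using ih hl.2

/-- contraction lowers the degree -/
theorem pderiv_degree (a : κ) (k : ℕ) (x : GA κ) (hx : x ∈ ⋀[ℂ]^(k+1) (κ → ℂ)) :
    pderiv κ a x ∈ ⋀[ℂ]^k (κ → ℂ) := by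
  induction k generalizing x with
  | zero =>
    rw [ExteriorAlgebra.exteriorPower, zero_add, pow_one] at hx
    obtain ⟨v, rfl⟩ := hx
    rw [← mul_one (ExteriorAlgebra.ι ℂ v), pderiv_ι_mul, pderiv_one, mul_zero, sub_zero,
      ExteriorAlgebra.exteriorPower, pow_zero]
    exact Submodule.smul_mem _ _ (Submodule.one_le.mp le_rfl)
  | succ k ih =>
    rw [ExteriorAlgebra.exteriorPower, pow_succ'] at hx
    induction hx using Submodule.mul_induction_on' with
    | mem_mul_mem m hm y hy =>
      obtain ⟨v, rfl⟩ := hm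
      rw [pderiv_ι_mul]
      refine Submodule.sub_mem _ (Submodule.smul_mem _ _ hy) ?_
      rw [ExteriorAlgebra.exteriorPower, pow_succ']
      exact Submodule.mul_mem_mul ⟨v, rfl⟩ (ih y hy)
    | add x _ y _ hx hy => rw [map_add]; exact Submodule.add_mem _ hx hy

theorem berezinAlong_degree_lt (l : List κ) (k : ℕ) (hk : k < l.length) (x : GA κ)
    (hx : x ∈ ⋀[ℂ]^k (κ → ℂ)) : berezinAlong l x = 0 := by
  induction l generalizing k x with
  | nil => simp at hk
  | cons a l ih =>
    rw [berezinAlong_cons]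
    cases k with
    | zero =>
      rw [ExteriorAlgebra.exteriorPower, pow_zero] at hx
      obtain ⟨r, rfl⟩ := Submodule.mem_one.mp hx
      rw [pderiv_algebraMap, map_zero]
    | succ k => exact ih k (by simpa using hk) _ (pderiv_degree a k x hx)

theorem commute_ι_mul_ι (v w : κ → ℂ) (x : GA κ) :
    Commute (ExteriorAlgebra.ι ℂ v * ExteriorAlgebra.ι ℂ w) x := by
  induction x using GA_induction with
  | hC r => exact (Algebra.commutes r _).symm
  | hadd x y hx hy => exact hx.add_right hy
  | hmul x u hx =>
    refine Commute.mul_right ?_ hx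
    have h1 := eq_neg_of_add_eq_zero_left (ExteriorAlgebra.ι_add_mul_swap (R := ℂ) w u)
    have h2 := eq_neg_of_add_eq_zero_left (ExteriorAlgebra.ι_add_mul_swap (R := ℂ) v u)
    rw [Commute, SemiconjBy, mul_assoc, h1, mul_neg, ← mul_assoc, h2, neg_mul, neg_neg, mul_assoc]

theorem exteriorPower_eq_zero [Fintype κ] (k : ℕ) (hk : Fintype.card κ < k) (x : GA κ)
    (hx : x ∈ ⋀[ℂ]^k (κ → ℂ)) : x = 0 := by
  rw [← ExteriorAlgebra.ιMulti_span_fixedDegree] at hx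
  have : Submodule.span ℂ (Set.range (ExteriorAlgebra.ιMulti ℂ k (M := κ → ℂ))) ≤ ⊥ := by
    rw [Submodule.span_le]
    rintro _ ⟨v, rfl⟩
    refine AlternatingMap.map_linearDependent _ v fun h => ?_
    have := h.fintype_card_le_finrank
    simp at this
    omega
  simpa using this hx

theorem mul_mem_two (v w : κ → ℂ) :
    ExteriorAlgebra.ι ℂ v * ExteriorAlgebra.ι ℂ w ∈ ⋀[ℂ]^2 (κ → ℂ) := by
  rw [ExteriorAlgebra.exteriorPower, pow_two]
  exact Submodule.mul_mem_mul ⟨v, rfl⟩ ⟨w, rfl⟩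

theorem pow_mem_degree (x : GA κ) (hx : x ∈ ⋀[ℂ]^2 (κ → ℂ)) (k : ℕ) :
    x ^ k ∈ ⋀[ℂ]^(2*k) (κ → ℂ) := by
  rw [ExteriorAlgebra.exteriorPower, pow_mul]
  exact Submodule.pow_mem_pow _ hx k

theorem pow_eq_zero_of_two [Fintype κ] (x : GA κ) (hx : x ∈ ⋀[ℂ]^2 (κ → ℂ)) (k : ℕ)
    (hk : Fintype.card κ < 2 * k) : x ^ k = 0 :=
  exteriorPower_eq_zero _ hk _ (pow_mem_degree x hx k)

theorem gexp_eq_exp (N : ℕ) (x : GA κ) (hx : x ^ N = 0) : gexp N x = IsNilpotent.exp x := by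
  rw [IsNilpotent.exp_eq_sum hx, gexp]
  refine Finset.sum_congr rfl fun k _ => ?_
  rw [← algebraMap_smul ℂ ((k.factorial : ℚ)⁻¹)]
  simp

theorem gexp_add (N : ℕ) (x y : GA κ) (hx : x ^ N = 0) (hy : y ^ N = 0)
    (hxy : (x + y) ^ N = 0) (h : Commute x y) : gexp N (x + y) = gexp N x * gexp N y := by
  rw [gexp_eq_exp _ _ hx, gexp_eq_exp _ _ hy, gexp_eq_exp _ _ hxy,
    IsNilpotent.exp_add_of_commute h ⟨N, hx⟩ ⟨N, hy⟩]

theorem map_gexp (f : (κ → ℂ) →ₗ[ℂ] (μ → ℂ)) (N : ℕ) (x : GA κ) :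
    ExteriorAlgebra.map f (gexp N x) = gexp N (ExteriorAlgebra.map f x) := by
  simp [gexp, map_sum, map_pow]

end helpers

section gaussian

theorem quadform_pow {m : ℕ} (M : Matrix (Fin m) (Fin m) ℂ) (k : ℕ) :
    quadform M ^ k = ∑ c : Fin k → Fin m × Fin m, (∏ j, M (c j).1 (c j).2) •
      (List.ofFn fun j => θv (c j).1 * θv (c j).2).prod := by
  have h : quadform M = ∑ p : Fin m × Fin m, M p.1 p.2 • (θv p.1 * θv p.2) := by
    rw [quadform, Fintype.sum_prod_type]
  rw [h, ← MultilinearMap.mkPiAlgebraFin_apply_const (R := ℂ), MultilinearMap.map_sum]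
  refine Finset.sum_congr rfl fun c _ => ?_
  rw [MultilinearMap.map_smul_univ (MultilinearMap.mkPiAlgebraFin ℂ k (GA (Fin m)))
    (fun j => M (c j).1 (c j).2) (fun j => θv (c j).1 * θv (c j).2)]
  rfl

/-- Regroup a function on `Fin (2k)` into pairs. -/
theorem pairs_bijective {α : Type*} (k : ℕ) :
    Function.Bijective (fun (d : Fin (2*k) → α) (j : Fin k) =>
      ((d ⟨2*j.val, by have := j.isLt; omega⟩, d ⟨2*j.val+1, by have := j.isLt; omega⟩) : α × α)) := by
  constructor
  · intro d d' h
    funext i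
    have hi := i.isLt
    have h1 := congrFun h ⟨i.val / 2, by omega⟩
    simp only [Prod.mk.injEq] at h1
    rcases Nat.mod_two_eq_zero_or_one i.val with h2 | h2
    · have e : i = ⟨2 * (i.val / 2), by omega⟩ := Fin.ext (by simp only; omega)
      rw [e]; exact h1.1
    · have e : i = ⟨2 * (i.val / 2) + 1, by omega⟩ := Fin.ext (by simp only; omega)
      rw [e]; exact h1.2
  · intro c
    refine ⟨fun i => if i.val % 2 = 0 then (c ⟨i.val / 2, by have := i.isLt; omega⟩).1
      else (c ⟨i.val / 2, by have := i.isLt; omega⟩).2, ?_⟩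
    funext j
    have e1 : 2 * j.val / 2 = j.val := by omega
    have e2 : (2 * j.val + 1) / 2 = j.val := by omega
    have e3 : (2 * j.val + 1) % 2 = 1 := by omega
    simp [e2, e3]

theorem quadform_pow' {m : ℕ} (M : Matrix (Fin m) (Fin m) ℂ) (k : ℕ) :
    quadform M ^ k = ∑ d : Fin (2*k) → Fin m,
      (∏ j : Fin k, M (d ⟨2*j.val, by have := j.isLt; omega⟩)
        (d ⟨2*j.val+1, by have := j.isLt; omega⟩)) •
      ExteriorAlgebra.ιMulti ℂ (2*k) (fun i => (Pi.single (d i) 1 : Fin m → ℂ)) := by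
  rw [quadform_pow]
  symm
  refine Fintype.sum_bijective _ (pairs_bijective k) _ _ fun d => ?_
  congr 1
  rw [ExteriorAlgebra.ιMulti_apply, List.ofFn_mul', List.prod_flatten, List.map_ofFn]
  congr 2
  funext j
  simp [List.ofFn_succ, θv]

theorem sum_fun_eq_sum_perm {m : ℕ} (F : (Fin m → Fin m) → ℂ) :
    ∑ d : Fin m → Fin m, F d • ExteriorAlgebra.ιMulti ℂ m
        (fun i => (Pi.single (d i) 1 : Fin m → ℂ)) =
      (∑ σ : Equiv.Perm (Fin m), ((Equiv.Perm.sign σ : ℤ) : ℂ) * F σ) •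
        ExteriorAlgebra.ιMulti ℂ m (fun i => (Pi.single i 1 : Fin m → ℂ)) := by
  classical
  rw [Finset.sum_smul]
  symm
  refine Finset.sum_of_injOn (fun σ : Equiv.Perm (Fin m) => (σ : Fin m → Fin m))
    (fun σ _ τ _ h => DFunLike.coe_injective h) (by simp) ?_ ?_
  · intro d _ hd
    have : ¬ Function.Injective d := fun hinj => hd
      ⟨Equiv.ofBijective d (Finite.injective_iff_bijective.mp hinj), by simp, rfl⟩
    rw [Function.not_injective_iff] at this
    obtain ⟨i, j, hij, hne⟩ := this
    rw [AlternatingMap.map_eq_zero_of_eq _ _ (by rw [hij]) hne, smul_zero]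
  · intro σ _
    have := AlternatingMap.map_perm (ExteriorAlgebra.ιMulti ℂ m)
      (fun i => (Pi.single i 1 : Fin m → ℂ)) σ
    have e : (fun i => (Pi.single (σ i) 1 : Fin m → ℂ)) =
      (fun i => (Pi.single i 1 : Fin m → ℂ)) ∘ σ := rfl
    rw [e, this, mul_comm, mul_smul]
    congr 1

theorem quadform_mem {m : ℕ} (M : Matrix (Fin m) (Fin m) ℂ) :
    quadform M ∈ ⋀[ℂ]^2 (Fin m → ℂ) :=
  Submodule.sum_mem _ fun _ _ => Submodule.sum_mem _ fun _ _ =>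
    Submodule.smul_mem _ _ (mul_mem_two _ _)

theorem berezin_top (m : ℕ) :
    berezin m (ExteriorAlgebra.ιMulti ℂ m (fun i => (Pi.single i 1 : Fin m → ℂ))) = 1 := by
  have h := berezinAlong_prod (List.ofFn (id : Fin m → Fin m))
    (List.nodup_ofFn.mpr Function.injective_id)
  rw [List.map_ofFn] at h
  exact h

theorem berezin_gaussian {n : ℕ} (M : Matrix (Fin (2*n)) (Fin (2*n)) ℂ) (N : ℕ) (hN : n < N) :
    berezin (2*n) (gexp N ((Complex.I / 2) • quadform M)) =
      algebraMap ℂ _ (Complex.I ^ n * pfaffian M) := by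
  rw [gexp, map_sum, Finset.sum_eq_single n]
  · rw [smul_pow, quadform_pow', sum_fun_eq_sum_perm (fun d => ∏ j : Fin n,
      M (d ⟨2*j.val, by have := j.isLt; omega⟩) (d ⟨2*j.val+1, by have := j.isLt; omega⟩))]
    rw [map_smul, map_smul, map_smul, berezin_top, smul_smul, smul_smul,
      Algebra.algebraMap_eq_smul_one, pfaffian]
    congr 1
    rw [div_pow, mul_inv]
    ring
  · intro k _ hk
    have hmem := pow_mem_degree _ (quadform_mem M) k
    rw [map_smul, smul_pow, map_smul]
    rcases lt_or_gt_of_ne hk with h | h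
    · rw [berezin, berezinAlong_degree_lt _ (2*k) (by simpa using h) _ hmem]
      simp
    · rw [pow_eq_zero_of_two _ (quadform_mem M) k (by simpa using h)]
      simp
  · intro h
    exact absurd (Finset.mem_range.mpr hN) h

/-- The shift map `θ_a ↦ θ_a - i ∑_b M⁻¹_{ba} η_b`. -/
noncomputable def shiftMap {m : ℕ} (K : Matrix (Fin m) (Fin m) ℂ) :
    (Fin m → ℂ) →ₗ[ℂ] (Fin m ⊕ Fin m → ℂ) where
  toFun v := Sum.elim v ((-Complex.I) • K.mulVec v)
  map_add' v w := by
    ext (i | i) <;> simp [Matrix.mulVec_add]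
  map_smul' c v := by
    ext (i | i) <;> simp [Matrix.mulVec_smul]
    ring

theorem shiftMap_single {m : ℕ} (K : Matrix (Fin m) (Fin m) ℂ) (a : Fin m) :
    shiftMap K (Pi.single a 1) = Pi.single (Sum.inl a) 1 +
      ∑ b, (-Complex.I * K b a) • (Pi.single (Sum.inr b) 1 : Fin m ⊕ Fin m → ℂ) := by
  ext (i | i)
  · simp [shiftMap, Pi.single_apply]
  · simp [shiftMap, Pi.single_apply, Finset.sum_apply]

theorem complete_square {m : ℕ} (M : Matrix (Fin m) (Fin m) ℂ) (hM : Mᵀ = -M)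
    (hinv : IsUnit M.det) :
    ExteriorAlgebra.map (shiftMap M⁻¹) (quadform M) =
      (∑ a, ∑ b, M a b • (θv (Sum.inl a : Fin m ⊕ Fin m) * θv (Sum.inl b)))
      + (-2 * Complex.I) • (∑ a, θv (Sum.inr a : Fin m ⊕ Fin m) * θv (Sum.inl a))
      + ∑ a, ∑ b, M⁻¹ a b • (θv (Sum.inr a : Fin m ⊕ Fin m) * θv (Sum.inr b)) := by
  set h : Fin m → GA (Fin m ⊕ Fin m) := fun b => θv (Sum.inr b) with hh
  set t : Fin m → GA (Fin m ⊕ Fin m) := fun b => θv (Sum.inl b) with ht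
  set z : Fin m → GA (Fin m ⊕ Fin m) := fun a => ∑ b, (-Complex.I * M⁻¹ b a) • h b with hz
  have hmap : ∀ a, ExteriorAlgebra.map (shiftMap M⁻¹) (θv a) = t a + z a := by
    intro a
    rw [θv, ExteriorAlgebra.map_apply_ι, shiftMap_single, map_add, map_sum]
    simp only [map_smul]
    rfl
  have hsk : ∀ a b, M a b = - M b a := fun a b => by
    have := congrFun (congrFun hM b) a
    simpa using this
  have hht : ∀ a b, t a * h b = -(h b * t a) := fun a b =>
    eq_neg_of_add_eq_zero_left (ExteriorAlgebra.ι_add_mul_swap _ _)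
  have hhh : ∀ a b, h a * h b = -(h b * h a) := fun a b =>
    eq_neg_of_add_eq_zero_left (ExteriorAlgebra.ι_add_mul_swap _ _)
  have hzt : ∀ a b, t a * z b = -(z b * t a) := fun a b => by
    simp only [hz, Finset.mul_sum, Finset.sum_mul, mul_smul_comm, smul_mul_assoc, hht, smul_neg,
      Finset.sum_neg_distrib]
  have key : ∀ b, ∑ a, M a b • z a = (-Complex.I) • h b := fun b => by
    simp only [hz, Finset.smul_sum, smul_smul]
    rw [Finset.sum_comm]
    simp only [← Finset.sum_smul]
    have e : ∀ c, ∑ a, M a b * (-Complex.I * M⁻¹ c a) = -Complex.I * (1 : Matrix _ _ ℂ) c b := by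
      intro c
      rw [← Matrix.nonsing_inv_mul M hinv, Matrix.mul_apply, Finset.mul_sum]
      exact Finset.sum_congr rfl fun a _ => by ring
    simp only [e, Matrix.one_apply]
    simp
  have third : ∀ y : Fin m → GA (Fin m ⊕ Fin m),
      ∑ a, ∑ b, M a b • (z a * y b) = (-Complex.I) • ∑ b, h b * y b := by
    intro y
    rw [Finset.sum_comm, Finset.smul_sum]
    refine Finset.sum_congr rfl fun b _ => ?_
    rw [← smul_mul_assoc, ← key, Finset.sum_mul]
    simp only [smul_mul_assoc]
  have second : ∑ a, ∑ b, M a b • (t a * z b) = (-Complex.I) • ∑ b, h b * t b := by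
    rw [← third, Finset.sum_comm]
    refine Finset.sum_congr rfl fun a _ => Finset.sum_congr rfl fun b _ => ?_
    rw [hzt, hsk, neg_smul, smul_neg, neg_neg]
  have fourth : (-Complex.I) • ∑ b, h b * z b = ∑ a, ∑ b, M⁻¹ a b • (h a * h b) := by
    simp only [hz, Finset.mul_sum, Finset.smul_sum, mul_smul_comm, smul_smul]
    rw [Finset.sum_comm]
    refine Finset.sum_congr rfl fun a _ => Finset.sum_congr rfl fun b _ => ?_
    rw [hhh, smul_neg, ← neg_smul]
    congr 1
    linear_combination (-(M⁻¹ a b)) * Complex.I_mul_I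
  rw [← fourth, ← third z]
  simp only [quadform, map_sum, map_smul, map_mul, hmap, add_mul, mul_add, smul_add,
    Finset.sum_add_distrib]
  rw [second, third t]
  module

end gaussian

/-- For an invertible complex antisymmetric `2n×2n` matrix `M`, with Grassmann
variables `θ_a = θv (Sum.inl a)` and `η_a = θv (Sum.inr a)` in `G_{4n}`,
`∫ Dθ exp(ηᵀθ + (i/2) θᵀMθ) = iⁿ Pf(M) · exp(-(i/2) ηᵀ M⁻¹ η)`. -/
theorem berezin_gaussian_integral_with_source {n : ℕ}
    (M : Matrix (Fin (2*n)) (Fin (2*n)) ℂ) (hM : Mᵀ = -M) (hinv : IsUnit M.det) :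
    berezinAlong (List.ofFn (Sum.inl : Fin (2*n) → Fin (2*n) ⊕ Fin (2*n)))
      (gexp (4*n+1)
        ((∑ a, θv (Sum.inr a : Fin (2*n) ⊕ Fin (2*n)) * θv (Sum.inl a))
          + (Complex.I / 2) • ∑ a, ∑ b, M a b •
              (θv (Sum.inl a : Fin (2*n) ⊕ Fin (2*n)) * θv (Sum.inl b))))
    = (Complex.I ^ n * pfaffian M) •
        gexp (4*n+1) ((-(Complex.I / 2)) • ∑ a, ∑ b, M⁻¹ a b •
          (θv (Sum.inr a : Fin (2*n) ⊕ Fin (2*n)) * θv (Sum.inr b))) := by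
  set T := ∑ a, ∑ b, M a b •
              (θv (Sum.inl a : Fin (2*n) ⊕ Fin (2*n)) * θv (Sum.inl b)) with hT
  set L := ∑ a, θv (Sum.inr a : Fin (2*n) ⊕ Fin (2*n)) * θv (Sum.inl a) with hL
  set Q := ∑ a, ∑ b, M⁻¹ a b •
          (θv (Sum.inr a : Fin (2*n) ⊕ Fin (2*n)) * θv (Sum.inr b)) with hQ
  have hTm : T ∈ ⋀[ℂ]^2 (Fin (2*n) ⊕ Fin (2*n) → ℂ) :=
    Submodule.sum_mem _ fun _ _ => Submodule.sum_mem _ fun _ _ =>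
      Submodule.smul_mem _ _ (mul_mem_two _ _)
  have hLm : L ∈ ⋀[ℂ]^2 (Fin (2*n) ⊕ Fin (2*n) → ℂ) :=
    Submodule.sum_mem _ fun _ _ => mul_mem_two _ _
  have hQm : Q ∈ ⋀[ℂ]^2 (Fin (2*n) ⊕ Fin (2*n) → ℂ) :=
    Submodule.sum_mem _ fun _ _ => Submodule.sum_mem _ fun _ _ =>
      Submodule.smul_mem _ _ (mul_mem_two _ _)
  have hsq : ExteriorAlgebra.map (shiftMap M⁻¹) ((Complex.I / 2) • quadform M) =
      (L + (Complex.I / 2) • T) + (Complex.I / 2) • Q := by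
    rw [map_smul, complete_square M hM hinv, smul_add, smul_add, smul_smul]
    have e : Complex.I / 2 * (-2 * Complex.I) = 1 := by
      linear_combination (-1 : ℂ) * Complex.I_mul_I
    rw [e, one_smul]
    abel
  set X := ExteriorAlgebra.map (shiftMap M⁻¹) ((Complex.I / 2) • quadform M) with hX
  have hXm : X ∈ ⋀[ℂ]^2 (Fin (2*n) ⊕ Fin (2*n) → ℂ) := by
    rw [hsq]
    exact Submodule.add_mem _ (Submodule.add_mem _ hLm (Submodule.smul_mem _ _ hTm))
      (Submodule.smul_mem _ _ hQm)
  have hY : (-(Complex.I / 2)) • Q ∈ ⋀[ℂ]^2 (Fin (2*n) ⊕ Fin (2*n) → ℂ) :=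
    Submodule.smul_mem _ _ hQm
  have hS : L + (Complex.I / 2) • T = X + (-(Complex.I / 2)) • Q := by
    rw [hsq]; module
  have hnil : ∀ x ∈ ⋀[ℂ]^2 (Fin (2*n) ⊕ Fin (2*n) → ℂ), x ^ (4*n+1) = 0 := fun x hx =>
    pow_eq_zero_of_two x hx _ (by simp; omega)
  have hcomm : Commute X ((-(Complex.I / 2)) • Q) := by
    refine Commute.smul_right ?_ _
    refine Commute.sum_right _ _ _ fun a _ => Commute.sum_right _ _ _ fun b _ =>
      Commute.smul_right ?_ _
    exact (commute_ι_mul_ι _ _ _).symm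
  have hpd : ∀ a ∈ List.ofFn (Sum.inl : Fin (2*n) → Fin (2*n) ⊕ Fin (2*n)),
      pderiv _ a (gexp (4*n+1) ((-(Complex.I / 2)) • Q)) = 0 := by
    intro a ha
    obtain ⟨i, rfl⟩ := List.mem_ofFn.mp ha
    refine pderiv_gexp _ _ ?_ _
    rw [map_smul, hQ, map_sum, Finset.sum_eq_zero, smul_zero]
    intro a _
    rw [map_sum]
    refine Finset.sum_eq_zero fun b _ => ?_
    have h2 : pderiv (Fin (2*n) ⊕ Fin (2*n)) (Sum.inl i) (θv (Sum.inr b)) = 0 := by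
      have := pderiv_prod (Sum.inl i : Fin (2*n) ⊕ Fin (2*n)) [Sum.inr b] (by simp)
      simpa using this
    rw [map_smul]
    nth_rewrite 1 [θv]
    rw [pderiv_ι_mul, h2]
    simp
  rw [hS, gexp_add _ _ _ (hnil _ hXm) (hnil _ hY) (hnil _ (Submodule.add_mem _ hXm hY)) hcomm,
    berezinAlong_mul_right _ _ hpd, hX, ← map_gexp]
  have hb := berezinAlong_map (shiftMap M⁻¹) (Sum.inl : Fin (2*n) → Fin (2*n) ⊕ Fin (2*n))
    (fun v a => rfl) (List.ofFn id) (gexp (4*n+1) ((Complex.I / 2) • quadform M))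
  rw [List.map_ofFn] at hb
  have hg := berezin_gaussian M (4*n+1) (by omega)
  rw [berezin] at hg
  rw [hg, AlgHom.commutes] at hb
  rw [Algebra.smul_def (Complex.I ^ n * pfaffian M), ← hb]
  rfl
end

section
/- Let ω: C_{2n} → G_{2n} be the linear isomorphism sending the ordered monomial c_{a_1}⋯c_{a_p} (a_1<⋯<a_p) to θ_{a_1}⋯θ_{a_p} and 1 to 1. Then for any X, Y ∈ C_{2n}: tr(XY) = (-2)ⁿ ∫ Dθ Dμ exp(θᵀμ) ω(X)(θ) ω(Y)(μ), where tr is the trace in the 2ⁿ-dimensional representation of C_{2n}. -/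
open scoped BigOperators
open Matrix

namespace TF

noncomputable def sg : ℕ → ℂ
  | 0 => 1
  | p+1 => (-1)^p * sg p

theorem sg_sq (p : ℕ) : sg p * sg p = 1 := by
  induction p with
  | zero => simp [sg]
  | succ p ih =>
    have : ((-1:ℂ)^p) * (-1)^p = 1 := by rw [← mul_pow]; simp
    simp only [sg]
    linear_combination ih * ((-1:ℂ)^p) * (-1)^p + this

theorem sg_even (n : ℕ) : sg (2*n) = (-1)^n := by
  induction n with
  | zero => simp [sg]
  | succ n ih =>
    rw [show 2*(n+1) = 2*n+1+1 by ring]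
    simp only [sg, ih]
    rw [pow_succ, pow_mul, pow_succ (-1 : ℂ) n]; simp

section ring
variable {A ι : Type*} [Ring A] [Algebra ℂ A]

theorem anti_prod (x : A) (f : ι → A) (l : List ι) (h : ∀ b ∈ l, x * f b = -(f b * x)) :
    x * (l.map f).prod = (-1:ℂ)^l.length • ((l.map f).prod * x) := by
  induction l with
  | nil => simp
  | cons b l ih =>
    have ih' := ih (fun b' hb => h b' (by simp [hb]))
    simp only [List.map_cons, List.prod_cons, List.length_cons]
    rw [← mul_assoc, h b (by simp), neg_mul, mul_assoc, ih', pow_succ]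
    simp [mul_assoc]

theorem comm_prod (x : A) (f : ι → A) (ε : ι → ℂ) (l : List ι)
    (h : ∀ b ∈ l, x * f b = ε b • (f b * x)) :
    x * (l.map f).prod = (l.map ε).prod • ((l.map f).prod * x) := by
  induction l with
  | nil => simp
  | cons b l ih =>
    have ih' := ih (fun b' hb => h b' (by simp [hb]))
    simp only [List.map_cons, List.prod_cons]
    rw [← mul_assoc, h b (by simp), smul_mul_assoc, mul_assoc, ih']
    simp [mul_assoc, smul_smul]

theorem pair_prod (f g : ι → A) (l : List ι) (hl : l.Nodup)
    (h : ∀ a b, a ≠ b → g a * f b = -(f b * g a)) :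
    (l.map f).prod * (l.map g).prod = sg l.length • (l.map (fun a => f a * g a)).prod := by
  induction l with
  | nil => simp [sg]
  | cons a l ih =>
    have hn := List.nodup_cons.1 hl
    have ih' := ih hn.2
    have h1 := anti_prod (g a) f l (fun b hb => h a b (by rintro rfl; exact hn.1 hb))
    have h2 : (l.map f).prod * g a = (-1:ℂ)^l.length • (g a * (l.map f).prod) := by
      rw [h1, smul_smul, ← mul_pow]; simp
    simp only [List.map_cons, List.prod_cons, List.length_cons, sg]
    calc f a * (l.map f).prod * (g a * (l.map g).prod)
        = f a * ((l.map f).prod * g a) * (l.map g).prod := by simp only [mul_assoc]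
      _ = (-1:ℂ)^l.length • (f a * g a * ((l.map f).prod * (l.map g).prod)) := by
          rw [h2]; simp only [mul_assoc, mul_smul_comm, smul_mul_assoc]
      _ = _ := by rw [ih', mul_smul_comm, smul_smul]

theorem exp_prod (x : ι → A) (hc : ∀ a b, Commute (x a) (x b)) (hx : ∀ a, x a * x a = 0)
    (l : List ι) (M : ℕ) (hM : l.length < M) :
    gexp M ((l.map x).sum) = (l.map (fun a => 1 + x a)).prod := by
  let _ : Module ℚ A := Module.compHom A (algebraMap ℚ ℂ)
  have hcs : ∀ a (l : List ι), Commute (x a) (l.map x).sum := by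
    intro a l
    induction l with
    | nil => simp
    | cons b l ih => simpa using (hc a b).add_right ih
  have hnil : ∀ l : List ι, (l.map x).sum ^ (l.length+1) = 0 := by
    intro l
    induction l with
    | nil => simp
    | cons b l ih =>
      simp only [List.map_cons, List.sum_cons, List.length_cons]
      exact (hcs b l).add_pow_eq_zero_of_add_le_succ_of_pow_eq_zero (m := 2)
        (by rw [pow_two, hx]) ih (by omega)
  have hexp : ∀ l : List ι, IsNilpotent.exp (l.map x).sum = (l.map (fun a => 1 + x a)).prod := by
    intro l
    induction l with
    | nil => simp [IsNilpotent.exp_zero]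
    | cons b l ih =>
      simp only [List.map_cons, List.sum_cons, List.prod_cons]
      rw [IsNilpotent.exp_add_of_commute (hcs b l) ⟨2, by rw [pow_two, hx]⟩ ⟨_, hnil l⟩, ih,
        IsNilpotent.exp_eq_sum (k := 2) (by rw [pow_two, hx])]
      simp [Finset.sum_range_succ]
  rw [← hexp, IsNilpotent.exp_eq_sum (pow_eq_zero_of_le (by omega : l.length + 1 ≤ M) (hnil l))]
  unfold gexp
  refine Finset.sum_congr rfl fun k _ => ?_
  have : ((k.factorial : ℚ)⁻¹) • ((l.map x).sum ^ k)
    = (algebraMap ℚ ℂ ((k.factorial : ℚ)⁻¹)) • ((l.map x).sum ^ k) := rfl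
  rw [this]; simp

end ring

section cliff
variable {n : ℕ} (c : Fin (2*n) → Matrix (Fin (2^n)) (Fin (2^n)) ℂ)

noncomputable abbrev cS (S : Finset (Fin (2*n))) : Matrix (Fin (2^n)) (Fin (2^n)) ℂ :=
  (S.sort (· ≤ ·) |>.map c).prod

theorem sort_prod {N : ℕ} (S : Finset (Fin N)) (f : Fin N → ℂ) :
    ((S.sort (· ≤ ·)).map f).prod = ∏ a ∈ S, f a := by
  rw [((Finset.sort_perm_toList S (· ≤ ·)).map f).prod_eq]
  simp

theorem eps_prod {N : ℕ} (S : Finset (Fin N)) (a : Fin N) :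
    ∏ b ∈ S, (if b = a then (1:ℂ) else -1) = (-1)^S.card * (if a ∈ S then -1 else 1) := by
  have : ∀ b, (if b = a then (1:ℂ) else -1) = (-1) * (if b = a then -1 else 1) := by
    intro b; split_ifs <;> simp
  simp_rw [this, Finset.prod_mul_distrib, Finset.prod_const, Finset.prod_ite_eq']


theorem c_sq
    (hrel : ∀ a b, c a * c b + c b * c a = if a = b then 2 else 0) (a) : c a * c a = 1 := by
  have h := hrel a a
  simp only [if_true] at h
  have h2 : (2:ℂ) • (c a * c a) = (2:ℂ) • 1 := by
    rw [two_smul, two_smul, h]; norm_num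
  exact smul_right_injective _ (two_ne_zero) h2

theorem c_anti
    (hrel : ∀ a b, c a * c b + c b * c a = if a = b then 2 else 0) (a b) (h : a ≠ b) : c a * c b = -(c b * c a) := by
  have := hrel a b
  rw [if_neg h] at this
  exact eq_neg_of_add_eq_zero_left this

theorem trace_same
    (hrel : ∀ a b, c a * c b + c b * c a = if a = b then 2 else 0) (S) : (cS c S * cS c S).trace = 2^n * sg S.card := by
  unfold cS
  rw [pair_prod c c _ (Finset.sort_nodup _ _) (fun a b h => c_anti c hrel a b h)]
  simp [c_sq c hrel, Matrix.trace_smul, mul_comm]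

theorem trace_diff
    (hrel : ∀ a b, c a * c b + c b * c a = if a = b then 2 else 0) (S T) (hST : S ≠ T) : (cS c S * cS c T).trace = 0 := by
  have key : ∀ a S, c a * cS c S = ((-1)^S.card * (if a ∈ S then -1 else 1) : ℂ) • (cS c S * c a) := by
    intro a S
    unfold cS
    rw [comm_prod (c a) c (fun b => if b = a then 1 else -1), sort_prod, eps_prod]
    intro b _
    split_ifs with h
    · subst h; simp
    · rw [c_anti c hrel a b (Ne.symm h)]; simp
  have hex : ∃ a, ((-1)^S.card * (if a ∈ S then -1 else 1) : ℂ) * ((-1)^T.card * (if a ∈ T then -1 else 1)) = -1 := by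
    rcases Nat.even_or_odd (S.card + T.card) with h | h
    · obtain ⟨a, ha⟩ : ∃ a, ¬ (a ∈ S ↔ a ∈ T) := by
        by_contra! hh; exact hST (Finset.ext hh)
      refine ⟨a, ?_⟩
      have h1 : (-1:ℂ)^S.card * (-1)^T.card = 1 := by rw [← pow_add, h.neg_one_pow]
      by_cases h2 : a ∈ S <;> by_cases h3 : a ∈ T <;> simp [h2, h3] at ha ⊢ <;> exact h1
    · obtain ⟨a, ha⟩ : ∃ a, (a ∈ S ↔ a ∈ T) := by
        by_contra! hh
        have : T = Sᶜ := by
          ext a; have := hh a; simp only [Finset.mem_compl]; tauto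
        rw [this, Finset.card_add_card_compl] at h
        simp [Nat.odd_iff] at h
      refine ⟨a, ?_⟩
      have h1 : (-1:ℂ)^S.card * (-1)^T.card = -1 := by rw [← pow_add, h.neg_one_pow]
      by_cases h2 : a ∈ S <;> by_cases h3 : a ∈ T <;> simp [h2, h3] at ha ⊢ <;> exact h1
  obtain ⟨a, ha⟩ := hex
  have h1 : c a * (cS c S * cS c T) = -((cS c S * cS c T) * c a) := by
    rw [← mul_assoc, key a S, smul_mul_assoc, mul_assoc, key a T, mul_smul_comm, smul_smul, ha,
      mul_assoc]
    simp
  have h2 : (cS c S * cS c T).trace = - (cS c S * cS c T).trace := by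
    calc (cS c S * cS c T).trace = (c a * (c a * (cS c S * cS c T))).trace := by
          rw [← mul_assoc, c_sq c hrel, one_mul]
      _ = - (cS c S * cS c T).trace := by
          rw [h1, mul_neg, Matrix.trace_neg, Matrix.trace_mul_comm, mul_assoc, c_sq c hrel, mul_one]
  exact self_eq_neg.1 h2

theorem span_c
    (hrel : ∀ a b, c a * c b + c b * c a = if a = b then 2 else 0) : Submodule.span ℂ (Set.range (cS c)) = ⊤ := by
  have hli : LinearIndependent ℂ (cS c) := by
    rw [Fintype.linearIndependent_iff]
    intro g hg T
    have h1 : ((∑ S, g S • cS c S) * cS c T).trace = 0 := by rw [hg]; simp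
    rw [Finset.sum_mul, Matrix.trace_sum, Finset.sum_eq_single T] at h1
    · rw [smul_mul_assoc, Matrix.trace_smul, trace_same c hrel] at h1
      have h3 := sg_sq T.card
      have h4 : sg T.card ≠ 0 := by intro h; simp [h] at h3
      simpa [h4] using h1
    · intro S _ hS
      rw [smul_mul_assoc, Matrix.trace_smul, trace_diff c hrel S T hS, smul_zero]
    · simp
  apply hli.span_eq_top_of_card_eq_finrank
  simp [Module.finrank_matrix, two_mul, pow_add]

end cliff
section grass
variable {ι : Type*} [DecidableEq ι]

theorem θv_anti (a b : ι) : θv a * θv b = -(θv b * θv a) := by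
  unfold θv
  exact eq_neg_of_add_eq_zero_left (ExteriorAlgebra.ι_add_mul_swap _ _)

theorem θv_sq (a : ι) : θv a * θv a = 0 := ExteriorAlgebra.ι_sq_zero _

theorem pderiv_mul (a b : ι) (y : GA ι) :
    pderiv ι a (θv b * y) = (if a = b then (1:ℂ) else 0) • y - θv b * pderiv ι a y := by
  have := CliffordAlgebra.contractLeft_ι_mul (Q := (0 : QuadraticForm ℂ (ι → ℂ)))
    (LinearMap.proj a) (Pi.single b 1) y
  unfold pderiv θv
  refine Eq.trans this ?_
  simp [Pi.single_apply]

theorem pderiv_one (a : ι) : pderiv ι a 1 = 0 := CliffordAlgebra.contractLeft_one _ _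

theorem pderiv_comm (a b : ι) (z : GA ι) :
    pderiv ι a (pderiv ι b z) = -(pderiv ι b (pderiv ι a z)) :=
  CliffordAlgebra.contractLeft_comm _ _ _

def Kp (a : ι) (z : GA ι) : Prop := ∀ y, pderiv ι a y = 0 → pderiv ι a (z * y) = 0

theorem Kp.one (a : ι) : Kp a 1 := fun y hy => by simpa using hy
theorem Kp.mul {a : ι} {z w : GA ι} (hz : Kp a z) (hw : Kp a w) : Kp a (z * w) := fun y hy => by
  rw [mul_assoc]; exact hz _ (hw _ hy)
theorem Kp.add {a : ι} {z w : GA ι} (hz : Kp a z) (hw : Kp a w) : Kp a (z + w) := fun y hy => by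
  rw [add_mul, map_add, hz y hy, hw y hy, add_zero]
theorem Kp.gen {a b : ι} (h : a ≠ b) : Kp a (θv b) := fun y hy => by
  rw [pderiv_mul, hy, if_neg h]; simp
theorem Kp.list {κ : Type*} {a : ι} (f : κ → GA ι) (l : List κ) (h : ∀ b ∈ l, Kp a (f b)) :
    Kp a (l.map f).prod := by
  induction l with
  | nil => exact Kp.one a
  | cons b l ih =>
    simp only [List.map_cons, List.prod_cons]
    exact (h b (by simp)).mul (ih fun b' hb => h b' (by simp [hb]))
theorem Kp.zero {a : ι} {z : GA ι} (hz : Kp a z) : pderiv ι a z = 0 := by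
  simpa using hz 1 (pderiv_one a)

theorem foldl_acc (l : List ι) (g : GA ι →ₗ[ℂ] GA ι) :
    l.foldl (fun acc a => pderiv ι a ∘ₗ acc) g = berezinAlong l ∘ₗ g := by
  unfold berezinAlong
  induction l generalizing g with
  | nil => rfl
  | cons b l ih =>
    simp only [List.foldl_cons]
    rw [ih, ih (pderiv ι b ∘ₗ LinearMap.id)]
    rfl

theorem berezin_cons (b : ι) (l : List ι) (z : GA ι) :
    berezinAlong (b :: l) z = berezinAlong l (pderiv ι b z) := by
  conv_lhs => unfold berezinAlong
  rw [List.foldl_cons, foldl_acc]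
  rfl

theorem berezin_kill (a : ι) (l : List ι) (ha : a ∈ l) (z : GA ι) (hz : pderiv ι a z = 0) :
    berezinAlong l z = 0 := by
  induction l generalizing z with
  | nil => simp at ha
  | cons b l ih =>
    rw [berezin_cons]
    by_cases h : a = b
    · subst h; rw [hz, map_zero]
    · apply ih (by simpa [h] using ha)
      rw [pderiv_comm, hz, map_zero, neg_zero]

theorem berezin_one (l : List ι) (hl : l.Nodup) : berezinAlong l (l.map θv).prod = 1 := by
  induction l with
  | nil => rfl
  | cons b l ih =>
    have hn := List.nodup_cons.1 hl
    rw [berezin_cons, List.map_cons, List.prod_cons, pderiv_mul,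
      (Kp.list (a := b) θv l (fun b' hb => Kp.gen (by rintro rfl; exact hn.1 hb))).zero]
    simpa using ih hn.2

end grass

section main
variable {N : ℕ}

noncomputable abbrev tv (a : Fin N) : GA (Fin N ⊕ Fin N) := θv (Sum.inl a)
noncomputable abbrev uv (a : Fin N) : GA (Fin N ⊕ Fin N) := θv (Sum.inr a)
noncomputable abbrev xv (a : Fin N) : GA (Fin N ⊕ Fin N) := tv a * uv a

noncomputable abbrev BJ (N : ℕ) : GA (Fin N ⊕ Fin N) →ₗ[ℂ] GA (Fin N ⊕ Fin N) :=
  berezinAlong (List.ofFn (Sum.inr : Fin N → Fin N ⊕ Fin N)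
            ++ List.ofFn (Sum.inl : Fin N → Fin N ⊕ Fin N))

theorem BJ_kill (a : Fin N ⊕ Fin N) (z : GA (Fin N ⊕ Fin N)) (hz : Kp a z) : BJ N z = 0 := by
  apply berezin_kill a _ _ _ hz.zero
  rcases a with a | a <;> simp

theorem θv_comm_xv (b : Fin N ⊕ Fin N) (a : Fin N) : Commute (θv b) (xv a) := by
  unfold Commute SemiconjBy xv tv uv
  rw [← mul_assoc, θv_anti b, neg_mul, mul_assoc, θv_anti b, mul_neg, neg_neg, mul_assoc]

theorem xv_comm (a b : Fin N) : Commute (xv a) (xv b) :=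
  (θv_comm_xv _ b).mul_left (θv_comm_xv _ b)

theorem tv_xv (a : Fin N) : tv a * xv a = 0 := by
  unfold xv tv; rw [← mul_assoc, θv_sq, zero_mul]

theorem uv_xv (a : Fin N) : uv a * xv a = 0 := by
  unfold xv uv; rw [(θv_comm_xv (Sum.inr a) a).eq, mul_assoc, θv_sq, mul_zero]

theorem xv_sq (a : Fin N) : xv a * xv a = 0 := by
  rw [show xv a * xv a = tv a * (uv a * xv a) from mul_assoc _ _ _, uv_xv, mul_zero]

theorem xv_kp {a : Fin N ⊕ Fin N} {b : Fin N} (h1 : a ≠ Sum.inl b) (h2 : a ≠ Sum.inr b) :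
    Kp a (xv b) := (Kp.gen h1).mul (Kp.gen h2)

theorem perm_one (l m : List (Fin N)) (h : l.Perm m) :
    (l.map (fun a => 1 + xv a)).prod = (m.map (fun a => 1 + xv a)).prod := by
  apply (h.map _).prod_eq'
  rw [List.pairwise_map]
  refine List.pairwise_of_forall fun a b => ?_
  exact ((Commute.one_left _).add_left ((Commute.one_right _).add_right (xv_comm a b)))

theorem perm_x (l m : List (Fin N)) (h : l.Perm m) :
    (l.map xv).prod = (m.map xv).prod := by
  apply (h.map _).prod_eq'
  rw [List.pairwise_map]
  exact List.pairwise_of_forall fun a b => xv_comm a b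

/-- a nilpotent partner kills the product -/
theorem x_mul_prod (a : Fin N) (f : Fin N → GA (Fin N ⊕ Fin N)) (l : List (Fin N)) (ha : a ∈ l)
    (hf : ∀ b, Commute (xv a) (f b)) (h0 : xv a * f a = 0) : xv a * (l.map f).prod = 0 := by
  induction l with
  | nil => simp at ha
  | cons b l ih =>
    simp only [List.map_cons, List.prod_cons]
    by_cases h : a = b
    · subst h; rw [← mul_assoc, h0, zero_mul]
    · rw [← mul_assoc, (hf b).eq, mul_assoc, ih (by simpa [h] using ha), mul_zero]

noncomputable abbrev EE (N : ℕ) : GA (Fin N ⊕ Fin N) :=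
  ((List.finRange N).map (fun a => 1 + xv a)).prod

theorem EE_erase (a : Fin N) : EE N =
    (((List.finRange N).erase a).map (fun a => 1 + xv a)).prod * (1 + xv a) := by
  unfold EE
  rw [perm_one _ (((List.finRange N).erase a) ++ [a])]
  · simp
  · exact (List.perm_cons_erase (List.mem_finRange a)).trans (List.perm_append_singleton _ _).symm

theorem BJ_diff (l m : List (Fin N)) (a : Fin N) (h : ¬ (a ∈ l ↔ a ∈ m)) :
    BJ N (EE N * (l.map tv).prod * (m.map uv).prod) = 0 := by
  have hcomm : ∀ l : List (Fin N), ∀ f : Fin N → GA (Fin N ⊕ Fin N),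
      (∀ b, Commute (xv a) (f b)) → Commute (xv a) (l.map f).prod := by
    intro l f hf
    apply Commute.list_prod_right
    intro z hz
    obtain ⟨b, _, rfl⟩ := List.mem_map.1 hz
    exact hf b
  have ht : ∀ b, Commute (xv a) (tv b) := fun b => (θv_comm_xv _ a).symm
  have hu : ∀ b, Commute (xv a) (uv b) := fun b => (θv_comm_xv _ a).symm
  have hx0 : xv a * ((l.map tv).prod * (m.map uv).prod) = 0 := by
    by_cases hl : a ∈ l
    · rw [← mul_assoc, x_mul_prod a tv l hl ht (by rw [(ht a).eq, tv_xv]), zero_mul]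
    · have hm : a ∈ m := by tauto
      rw [← mul_assoc, (hcomm l tv ht).eq, mul_assoc,
        x_mul_prod a uv m hm hu (by rw [(hu a).eq, uv_xv]), mul_zero]
  have hE : EE N * (l.map tv).prod * (m.map uv).prod =
      (((List.finRange N).erase a).map (fun a => 1 + xv a)).prod *
        ((l.map tv).prod * (m.map uv).prod) := by
    rw [EE_erase a, mul_assoc, mul_assoc, add_mul, hx0, one_mul, add_zero]
  rw [hE]
  have hkE : ∀ s : Fin N ⊕ Fin N, (s = Sum.inl a ∨ s = Sum.inr a) →
      Kp s (((List.finRange N).erase a).map (fun a => 1 + xv a)).prod := by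
    intro s hs
    apply Kp.list
    intro b hb
    have hab : b ≠ a := ((List.nodup_finRange N).mem_erase_iff.1 hb).1
    refine (Kp.one _).add (xv_kp ?_ ?_) <;> rcases hs with rfl | rfl <;> simp [hab.symm]
  by_cases hl : a ∈ l
  · have hm : a ∉ m := by tauto
    apply BJ_kill (Sum.inr a)
    refine (hkE _ (Or.inr rfl)).mul ((Kp.list _ _ fun b _ => Kp.gen (by simp)).mul
      (Kp.list _ _ fun b hb => Kp.gen ?_))
    rintro h; cases h; exact hm hb
  · apply BJ_kill (Sum.inl a)
    refine (hkE _ (Or.inl rfl)).mul ((Kp.list _ _ fun b hb => Kp.gen ?_).mul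
      (Kp.list _ _ fun b _ => Kp.gen (by simp)))
    rintro h; cases h; exact hl hb

theorem one_add_absorb (l m : List (Fin N)) (h : ∀ a ∈ l, a ∈ m) :
    (l.map (fun a => 1 + xv a)).prod * (m.map xv).prod = (m.map xv).prod := by
  induction l with
  | nil => simp
  | cons a l ih =>
    rw [List.map_cons, List.prod_cons, mul_assoc, ih (fun b hb => h b (by simp [hb])), add_mul,
      x_mul_prod a xv m (h a (by simp)) (fun b => xv_comm a b) (xv_sq a), one_mul, add_zero]

theorem BJ_replace (l : List (Fin N)) (hl : l.Nodup) (w v : GA (Fin N ⊕ Fin N))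
    (hw : ∀ a ∈ l, Kp (Sum.inl a) w) (hv : ∀ a ∈ l, Kp (Sum.inl a) v) :
    BJ N (w * (l.map (fun a => 1 + xv a)).prod * v) = BJ N (w * (l.map xv).prod * v) := by
  induction l generalizing w with
  | nil => rfl
  | cons a l ih =>
    have hn := List.nodup_cons.1 hl
    have hne : ∀ b ∈ l, b ≠ a := by rintro b hb rfl; exact hn.1 hb
    simp only [List.map_cons, List.prod_cons]
    rw [← mul_assoc w (xv a), ← ih hn.2 (w * xv a), mul_add_one_aux, map_add,
      BJ_kill (Sum.inl a), zero_add]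
    · refine ((hw a (by simp)).mul (Kp.list _ _ fun b hb => ?_)).mul (hv a (by simp))
      refine (Kp.one _).add (xv_kp ?_ ?_) <;> simp [(hne b hb).symm]
    · intro b hb
      refine (hw b (by simp [hb])).mul (xv_kp ?_ ?_) <;> simp [hne b hb]
    · intro b hb
      exact hv b (by simp [hb])
where
  mul_add_one_aux {A : Type _} [Ring A] {w x p v : A} :
      w * ((1 + x) * p) * v = w * p * v + w * x * p * v := by noncomm_ring

theorem BJ_full (hN : Even N) : BJ N ((List.finRange N).map xv).prod = algebraMap ℂ _ (sg N) := by
  have h1 := pair_prod tv uv (List.finRange N) (List.nodup_finRange N)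
    (fun a b _ => θv_anti (Sum.inr a) (Sum.inl b))
  rw [List.length_finRange] at h1
  have h2 : ((List.finRange N).map xv).prod
      = sg N • (((List.finRange N).map tv).prod * ((List.finRange N).map uv).prod) := by
    rw [h1, smul_smul, sg_sq, one_smul]
  have h3 : Commute ((List.finRange N).map tv).prod ((List.finRange N).map uv).prod := by
    apply Commute.list_prod_left
    intro z hz
    obtain ⟨b, _, rfl⟩ := List.mem_map.1 hz
    have := anti_prod (tv b) uv (List.finRange N) (fun a _ => θv_anti (Sum.inl b) (Sum.inr a))
    rw [List.length_finRange, hN.neg_one_pow, one_smul] at this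
    exact this
  have h4 : (((List.finRange N).map uv).prod * ((List.finRange N).map tv).prod) =
    ((List.ofFn (Sum.inr : Fin N → Fin N ⊕ Fin N)
            ++ List.ofFn (Sum.inl : Fin N → Fin N ⊕ Fin N)).map θv).prod := by
    simp [List.ofFn_eq_map, Function.comp_def]
  rw [h2, h3.eq, h4, map_smul, berezin_one, Algebra.algebraMap_eq_smul_one]
  rw [List.nodup_append]
  refine ⟨List.nodup_ofFn.2 Sum.inr_injective, List.nodup_ofFn.2 Sum.inl_injective, ?_⟩
  intro a ha b hb
  simp only [List.mem_ofFn] at ha hb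
  obtain ⟨a, rfl⟩ := ha
  obtain ⟨b, rfl⟩ := hb
  simp

theorem BJ_same (hN : Even N) (S : Finset (Fin N)) :
    BJ N (EE N * ((S.sort (· ≤ ·)).map tv).prod * ((S.sort (· ≤ ·)).map uv).prod)
      = algebraMap ℂ _ (sg N * sg S.card) := by
  set l := S.sort (· ≤ ·) with hl
  set m := Sᶜ.sort (· ≤ ·) with hm
  have hperm : (List.finRange N).Perm (m ++ l) := by
    rw [List.perm_ext_iff_of_nodup (List.nodup_finRange N)]
    · intro a; simp [hl, hm]; tauto
    · rw [List.nodup_append]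
      refine ⟨Finset.sort_nodup _ _, Finset.sort_nodup _ _, ?_⟩
      rintro a ha b hb rfl
      simp [hl, hm] at ha hb; exact ha hb
  have hE : EE N = (m.map (fun a => 1 + xv a)).prod * (l.map (fun a => 1 + xv a)).prod := by
    unfold EE; rw [perm_one _ _ hperm]; simp
  rw [mul_assoc, pair_prod tv uv l (Finset.sort_nodup _ _)
    (fun a b _ => θv_anti (Sum.inr a) (Sum.inl b)), mul_smul_comm, map_smul, hE, mul_assoc]
  rw [show (fun a : Fin N => tv a * uv a) = xv from rfl, one_add_absorb l l (fun _ h => h)]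
  have h1 := BJ_replace m (Finset.sort_nodup _ _) 1 (l.map xv).prod (fun a _ => Kp.one _) (by
    intro a ha
    refine Kp.list _ _ fun b hb => xv_kp ?_ ?_
    · rintro h; cases h
      simp [hl, hm] at ha hb; exact ha hb
    · simp)
  rw [one_mul, one_mul] at h1
  rw [h1, ← List.prod_append, ← List.map_append, ← perm_x _ _ hperm, BJ_full hN,
    Algebra.smul_def, ← map_mul, mul_comm, hl, Finset.length_sort]

end main

end TF

/-- the trace formula
`tr(XY) = (-2)ⁿ ∫ Dθ Dμ exp(θᵀμ) ω(X)(θ) ω(Y)(μ)`,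
where `ω` sends ordered Clifford monomials `c_{a_1}⋯c_{a_p}` (with `a_1<⋯<a_p`) to the
corresponding Grassmann monomials, and the trace is in the `2ⁿ`-dimensional representation.
Here `θ_a = θv (Sum.inl a)` and `μ_a = θv (Sum.inr a)`. -/
theorem trace_formula {n : ℕ}
    (c : Fin (2*n) → Matrix (Fin (2^n)) (Fin (2^n)) ℂ)
    (hrel : ∀ a b, c a * c b + c b * c a = if a = b then 2 else 0)
    (ωθ ωμ : Matrix (Fin (2^n)) (Fin (2^n)) ℂ →ₗ[ℂ] GA (Fin (2*n) ⊕ Fin (2*n)))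
    (hωθ : ∀ S : Finset (Fin (2*n)),
      ωθ ((S.sort (· ≤ ·) |>.map c).prod)
        = (S.sort (· ≤ ·) |>.map (fun a => θv (Sum.inl a : Fin (2*n) ⊕ Fin (2*n)))).prod)
    (hωμ : ∀ S : Finset (Fin (2*n)),
      ωμ ((S.sort (· ≤ ·) |>.map c).prod)
        = (S.sort (· ≤ ·) |>.map (fun a => θv (Sum.inr a : Fin (2*n) ⊕ Fin (2*n)))).prod)
    (X Y : Matrix (Fin (2^n)) (Fin (2^n)) ℂ) :
    algebraMap ℂ (GA (Fin (2*n) ⊕ Fin (2*n))) ((X * Y).trace)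
      = ((-2 : ℂ))^n •
        berezinAlong
          (List.ofFn (Sum.inr : Fin (2*n) → Fin (2*n) ⊕ Fin (2*n))
            ++ List.ofFn (Sum.inl : Fin (2*n) → Fin (2*n) ⊕ Fin (2*n)))
          (gexp (4*n+1) (∑ a, θv (Sum.inl a : Fin (2*n) ⊕ Fin (2*n)) * θv (Sum.inr a))
            * ωθ X * ωμ Y) := by
  have hgexp : gexp (4*n+1) (∑ a, θv (Sum.inl a : Fin (2*n) ⊕ Fin (2*n)) * θv (Sum.inr a))
      = TF.EE (2*n) := by
    have h := TF.exp_prod (TF.xv (N := 2*n)) TF.xv_comm TF.xv_sq (List.finRange (2*n)) (4*n+1)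
      (by simp; omega)
    rw [← List.ofFn_eq_map, List.sum_ofFn] at h
    exact h
  rw [hgexp]
  have key : ∀ S T : Finset (Fin (2*n)),
      algebraMap ℂ (GA (Fin (2*n) ⊕ Fin (2*n))) ((TF.cS c S * TF.cS c T).trace)
      = ((-2 : ℂ))^n • TF.BJ (2*n) (TF.EE (2*n) * ωθ (TF.cS c S) * ωμ (TF.cS c T)) := by
    intro S T
    rw [show ωθ (TF.cS c S) = ((S.sort (· ≤ ·)).map TF.tv).prod from hωθ S,
      show ωμ (TF.cS c T) = ((T.sort (· ≤ ·)).map TF.uv).prod from hωμ T]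
    by_cases hST : S = T
    · subst hST
      rw [TF.BJ_same (even_two_mul n), TF.trace_same c hrel, TF.sg_even, Algebra.smul_def,
        ← map_mul, ← mul_assoc, ← mul_pow]
      norm_num
    · obtain ⟨a, ha⟩ : ∃ a, ¬ (a ∈ S ↔ a ∈ T) := by
        by_contra! hh; exact hST (Finset.ext hh)
      rw [TF.BJ_diff _ _ a (by simpa using ha), TF.trace_diff c hrel S T hST]
      simp
  have hX : X ∈ Submodule.span ℂ (Set.range (TF.cS c)) := by rw [TF.span_c c hrel]; trivial
  have hY : Y ∈ Submodule.span ℂ (Set.range (TF.cS c)) := by rw [TF.span_c c hrel]; trivial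
  refine Submodule.span_induction₂
    (p := fun X Y _ _ => algebraMap ℂ (GA (Fin (2*n) ⊕ Fin (2*n))) ((X * Y).trace)
      = ((-2 : ℂ))^n • TF.BJ (2*n) (TF.EE (2*n) * ωθ X * ωμ Y)) ?_ ?_ ?_ ?_ ?_ ?_ ?_ hX hY
  · rintro _ _ ⟨S, rfl⟩ ⟨T, rfl⟩; exact key S T
  · intro y _; simp
  · intro x _; simp
  · intro x y z _ _ _ h1 h2
    simp only [add_mul, mul_add, map_add, Matrix.trace_add, smul_add, h1, h2]
  · intro x y z _ _ _ h1 h2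
    simp only [mul_add, map_add, Matrix.trace_add, smul_add, h1, h2]
  · intro r x y _ _ h
    rw [smul_mul_assoc, Matrix.trace_smul, smul_eq_mul, map_mul, h, ← Algebra.smul_def, smul_comm, map_smul,
      mul_smul_comm (s := r), smul_mul_assoc, map_smul]
  · intro r x y _ _ h
    rw [mul_smul_comm, Matrix.trace_smul, smul_eq_mul, map_mul, h, ← Algebra.smul_def, smul_comm, map_smul,
      mul_smul_comm (s := r), map_smul]
end

section
/- Let ρ be a Gaussian state of n fermionic modes with correlation matrix M (real antisymmetric, MᵀM ≤ I), and let K be the 2n×2n antisymmetric matrix with K_{12} = 1, K_{21} = -1, all other entries zero. Then the probability of finding the first mode empty satisfies [tr(ρ a_1 a_1†)]² = (1/4) det(MK - I), where a_1 a_1† = (1 + i c_1 c_2)/2. -/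
open scoped BigOperators
open Matrix

/-- The matrix `K` with `K_{12} = 1`, `K_{21} = -1` and all other entries zero. -/
noncomputable def Kmat (n : ℕ) : Matrix (Fin (2*n)) (Fin (2*n)) ℝ :=
  Matrix.of fun i j =>
    if i.val = 0 ∧ j.val = 1 then 1 else if i.val = 1 ∧ j.val = 0 then -1 else 0


lemma aux_comm {m : ℕ} {A : Type*} [Ring A] (c : Fin m → A)
    (hrel : ∀ a b, c a * c b + c b * c a = if a = b then 2 else 0) (b : Fin m) (l : List (Fin m)) :
    c b * (l.map c).prod = (-1) ^ (l.length + l.count b) * ((l.map c).prod * c b) := by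
  induction l with
  | nil => simp
  | cons a l ih =>
    by_cases h : a = b
    · subst h
      simp only [List.map_cons, List.prod_cons, List.length_cons, List.count_cons_self]
      have h1 : Commute ((-1 : A) ^ (l.length + l.count a)) (c a) :=
        ((Commute.one_left (c a)).neg_left).pow_left _
      rw [show l.length + 1 + (l.count a + 1) = (l.length + l.count a) + 2 by ring, pow_add,
        neg_one_sq, mul_one, mul_assoc (c a) _ (c a), ← mul_assoc ((-1 : A) ^ _) (c a), h1.eq, mul_assoc (c a), ← ih]
    · have h2 := hrel b a
      rw [if_neg (fun e => h e.symm)] at h2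
      have h3 : c b * c a = - (c a * c b) := eq_neg_of_add_eq_zero_left h2
      have h1 : Commute ((-1 : A) ^ (l.length + l.count b)) (c a) :=
        ((Commute.one_left (c a)).neg_left).pow_left _
      rw [List.map_cons, List.prod_cons, ← mul_assoc, h3, neg_mul, mul_assoc, ih,
        List.length_cons, List.count_cons_of_ne h,
        show l.length + 1 + l.count b = (l.length + l.count b) + 1 by ring, pow_succ,
        ← mul_assoc, ← h1.eq]
      simp [mul_assoc]

lemma aux_sq {m N : ℕ} (c : Fin m → Matrix (Fin N) (Fin N) ℂ)
    (hrel : ∀ a b, c a * c b + c b * c a = if a = b then 2 else 0) (b : Fin m) :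
    c b * c b = 1 := by
  have h := hrel b b
  rw [if_pos rfl, ← two_mul] at h
  have h2 : (2 : ℂ) • (c b * c b) = (2 : ℂ) • (1 : Matrix (Fin N) (Fin N) ℂ) := by
    rw [two_smul, two_smul, ← two_mul, h]; norm_num
  exact smul_right_injective _ (two_ne_zero) h2

lemma aux_trace {m N : ℕ} (c : Fin m → Matrix (Fin N) (Fin N) ℂ)
    (hrel : ∀ a b, c a * c b + c b * c a = if a = b then 2 else 0) (b : Fin m) (l : List (Fin m))
    (hodd : Odd (l.length + l.count b)) : ((l.map c).prod).trace = 0 := by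
  have h := aux_comm c hrel b l
  rw [hodd.neg_one_pow, neg_one_mul] at h
  have h2 : (c b * ((l.map c).prod * c b)).trace = ((l.map c).prod).trace := by
    rw [Matrix.trace_mul_comm, mul_assoc, aux_sq c hrel, mul_one]
  rw [← mul_assoc, h, neg_mul, mul_assoc, aux_sq c hrel, mul_one, Matrix.trace_neg] at h2
  have h3 : (2 : ℂ) * ((l.map c).prod).trace = 0 := by linear_combination -h2
  simpa using h3

lemma aux_rev {m N : ℕ} (c : Fin m → Matrix (Fin N) (Fin N) ℂ)
    (hrel : ∀ a b, c a * c b + c b * c a = if a = b then 2 else 0) (l : List (Fin m)) :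
    (l.reverse.map c).prod * (l.map c).prod = 1 := by
  induction l with
  | nil => simp
  | cons a l ih =>
    simp only [List.reverse_cons, List.map_append, List.prod_append, List.map_cons, List.map_nil,
      List.prod_cons, List.prod_nil, mul_one]
    rw [mul_assoc, ← mul_assoc (c a), aux_sq c hrel, one_mul, ih]

lemma aux_orth {n N : ℕ} (c : Fin (2 * n) → Matrix (Fin N) (Fin N) ℂ)
    (hrel : ∀ a b, c a * c b + c b * c a = if a = b then 2 else 0) (S T : Finset (Fin (2 * n))) :
    (((T.sort (· ≤ ·)).reverse.map c).prod * ((S.sort (· ≤ ·)).map c).prod).trace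
      = if S = T then (N : ℂ) else 0 := by
  split_ifs with h
  · subst h
    rw [aux_rev c hrel]; simp
  · rw [← List.prod_append, ← List.map_append]
    have hc : ∀ (U : Finset (Fin (2 * n))) b, (U.sort (· ≤ ·)).count b = if b ∈ U then 1 else 0 := by
      intro U b
      rw [List.Nodup.count (Finset.sort_nodup U (· ≤ ·))]; simp
    suffices hb : ∃ b, Odd (S.card + T.card + (if b ∈ S then 1 else 0) + (if b ∈ T then 1 else 0)) by
      obtain ⟨b, hb⟩ := hb
      apply aux_trace c hrel b
      simp only [List.length_append, List.length_reverse, List.count_append, List.count_reverse,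
        Finset.length_sort, hc]
      convert hb using 1; ring
    by_contra! hno
    simp only [Nat.not_odd_iff_even] at hno
    rcases Nat.even_or_odd (S.card + T.card) with he | ho
    · apply h
      ext b
      have := hno b
      by_cases h1 : b ∈ S <;> by_cases h2 : b ∈ T <;> simp [h1, h2] at this ⊢ <;> grind
    · have hST : T = Sᶜ := by
        ext b
        have := hno b
        by_cases h1 : b ∈ S <;> by_cases h2 : b ∈ T <;> simp [h1, h2] at this ⊢ <;> grind
      have := Finset.card_add_card_compl S
      rw [← hST, Fintype.card_fin] at this
      grind

lemma aux_span {n : ℕ} (c : Fin (2 * n) → Matrix (Fin (2^n)) (Fin (2^n)) ℂ)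
    (hrel : ∀ a b, c a * c b + c b * c a = if a = b then 2 else 0) :
    Submodule.span ℂ (Set.range fun S : Finset (Fin (2 * n)) => ((S.sort (· ≤ ·)).map c).prod)
      = ⊤ := by
  apply LinearIndependent.span_eq_top_of_card_eq_finrank'
  · rw [Fintype.linearIndependent_iff]
    intro g hg T
    have h := congrArg (fun X => (((T.sort (· ≤ ·)).reverse.map c).prod * X).trace) hg
    simp only [Finset.mul_sum, Matrix.trace_sum, Matrix.mul_smul, Matrix.trace_smul,
      aux_orth c hrel] at h
    simpa using h
  · simp [Module.finrank_matrix, pow_mul, ← mul_pow]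

noncomputable def eps (m : ℕ) : GA (Fin m) →ₐ[ℂ] ℂ := ExteriorAlgebra.algebraMapInv

lemma eps_θ {m : ℕ} (a : Fin m) : eps m (θv a) = 0 := by
  simp [eps, θv, ExteriorAlgebra.algebraMapInv]

lemma pd_mul {m : ℕ} (a b : Fin m) (y : GA (Fin m)) :
    pderiv (Fin m) a (θv b * y) = (if a = b then 1 else 0 : ℂ) • y - θv b * pderiv (Fin m) a y := by
  have := CliffordAlgebra.contractLeft_ι_mul (Q := (0 : QuadraticForm ℂ (Fin m → ℂ)))
    (d := LinearMap.proj a) (Pi.single b 1) y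
  simp only [LinearMap.proj_apply, Pi.single_apply] at this
  exact this

noncomputable def dd {m : ℕ} (p q : Fin m) : GA (Fin m) →ₗ[ℂ] ℂ :=
  (eps m).toLinearMap ∘ₗ pderiv (Fin m) q ∘ₗ pderiv (Fin m) p

lemma dd_one {m : ℕ} (p q : Fin m) : dd p q 1 = 0 := by
  have : pderiv (Fin m) p 1 = 0 := CliffordAlgebra.contractLeft_one (Q := 0) _
  simp [dd, this]

lemma dd_single {m : ℕ} (p q a : Fin m) : dd p q (θv a) = 0 := by
  have h : ∀ r, pderiv (Fin m) r 1 = 0 := fun r => CliffordAlgebra.contractLeft_one (Q := 0) _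
  have := pd_mul p a 1
  rw [mul_one, h, mul_zero, sub_zero] at this
  simp only [dd, LinearMap.comp_apply, this, map_smul, h, smul_zero, map_zero]

lemma dd_mul {m : ℕ} (p q a b : Fin m) (y : GA (Fin m)) :
    dd p q (θv a * θv b * y) = ((if p = a then 1 else 0) * (if q = b then 1 else 0)
      - (if p = b then 1 else 0) * (if q = a then 1 else 0)) * eps m y := by
  simp only [dd, LinearMap.comp_apply, mul_assoc, pd_mul, map_sub, map_smul, AlgHom.toLinearMap_apply,
    map_mul, eps_θ, smul_eq_mul, zero_mul, sub_zero, mul_sub]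
  ring

lemma eps_sort {m : ℕ} (l : List (Fin m)) :
    eps m ((l.map θv).prod) = if l = [] then 1 else 0 := by
  cases l <;> simp [eps_θ]

lemma dd_sort {m : ℕ} (p q : Fin m) (hpq : p < q) (S : Finset (Fin m)) :
    dd p q (((S.sort (· ≤ ·)).map θv).prod) = if S = {p, q} then 1 else 0 := by
  have hs := Finset.sortedLT_sort S
  have hS : S = (S.sort (· ≤ ·)).toFinset := (Finset.sort_toFinset _ _).symm
  have hcard : (S.sort (· ≤ ·)).length = S.card := Finset.length_sort _
  have h2 : S = {p, q} → S.card = 2 := fun h => by rw [h, Finset.card_pair hpq.ne]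
  generalize S.sort (· ≤ ·) = l at hs hS hcard
  match l with
  | [] =>
    rw [if_neg (fun h => by have := h2 h; simp at hcard; omega)]
    simp [dd_one]
  | [a] =>
    rw [if_neg (fun h => by have := h2 h; simp at hcard; omega)]
    simp [dd_single]
  | a :: b :: l =>
    rw [List.map_cons, List.map_cons, List.prod_cons, List.prod_cons, ← mul_assoc, dd_mul, eps_sort]
    rcases l with _ | ⟨d, l⟩
    · have hab : a < b := by have := hs.pairwise; simpa using this
      subst hS
      have : ([a, b].toFinset = {p, q}) ↔ (p = a ∧ q = b) := by
        constructor
        · intro h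
          simp [Finset.ext_iff] at h
          have := h a
          have := h b
          have := h p
          have := h q
          grind
        · rintro ⟨rfl, rfl⟩; simp
      simp only [this]
      grind
    · rw [if_neg (c := S = {p, q}) (fun h => by have := h2 h; simp at hcard; omega)]
      simp

lemma quad_mul {m : ℕ} (A : Matrix (Fin m) (Fin m) ℂ) (p q : Fin m) (y : GA (Fin m)) :
    dd p q (quadform A * y) = (A p q - A q p) * eps m y := by
  simp [quadform, Finset.sum_mul, dd_mul, mul_sub, sub_mul, Finset.sum_sub_distrib]

lemma eps_quad {m : ℕ} (A : Matrix (Fin m) (Fin m) ℂ) : eps m (quadform A) = 0 := by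
  simp [quadform, eps_θ]

lemma eps_gexp {m : ℕ} (A : Matrix (Fin m) (Fin m) ℂ) (z : ℂ) (k : ℕ) :
    eps m (gexp (k + 1) (z • quadform A)) = 1 := by
  rw [gexp, Finset.sum_range_succ', map_add, map_sum]
  simp [eps_quad]

lemma dd_gexp {m : ℕ} (A : Matrix (Fin m) (Fin m) ℂ) (z : ℂ) (k : ℕ) (p q : Fin m) :
    dd p q (gexp (k + 2) (z • quadform A)) = z * (A p q - A q p) := by
  rw [gexp, Finset.sum_range_succ', Finset.sum_range_succ', map_add, map_add, map_sum,
    Finset.sum_eq_zero]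
  · have := quad_mul A p q 1
    simp at this
    simp [dd_one, this]
  · intro i _
    rw [pow_succ', smul_mul_assoc]
    simp [quad_mul, eps_quad]

lemma det_K {n : ℕ} (M : Matrix (Fin (2*n)) (Fin (2*n)) ℝ) (hM : Mᵀ = -M)
    (p q : Fin (2*n)) (hp : p.val = 0) (hq : q.val = 1) :
    (M * Kmat n - 1).det = (1 + M p q) ^ 2 := by
  have hd : ∀ i j, M i j = - M j i := fun i j => by
    have := congrFun (congrFun hM j) i
    simpa using this
  let A : Matrix (Fin (2*n)) (Fin 2) ℝ := Matrix.of fun i j =>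
    if j = 0 then (if i = p then 1 else 0) else (if i = q then -1 else 0)
  let B : Matrix (Fin 2) (Fin (2*n)) ℝ := Matrix.of fun j i =>
    if j = 0 then (if i = q then 1 else 0) else (if i = p then 1 else 0)
  have hK : Kmat n = A * B := by
    ext i j
    simp only [Kmat, A, B, Matrix.mul_apply, Matrix.of_apply, Fin.sum_univ_two, Fin.ext_iff, hp, hq]
    simp
    grind
  have hneg : M * Kmat n - 1 = -(1 - M * A * B) := by rw [hK, Matrix.mul_assoc]; abel
  rw [hneg, Matrix.det_neg, Fintype.card_fin, pow_mul, Matrix.det_one_sub_mul_comm, Matrix.det_fin_two]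
  have hpp : M p p = 0 := by linarith [hd p p]
  have hqq : M q q = 0 := by linarith [hd q q]
  simp [A, B, Matrix.mul_apply, hpp, hqq, hd q p]
  ring

/-- for a Gaussian state `ρ` with correlation matrix `M` (real antisymmetric,
`MᵀM ≤ I`), the probability of finding the first mode empty satisfies
`[tr(ρ a_1 a_1†)]² = (1/4) det(MK - I)`, where `a_1 a_1† = (1 + i c_1 c_2)/2`. -/
theorem empty_mode_probability {n : ℕ} (hn : 0 < n)
    (c : Fin (2*n) → Matrix (Fin (2^n)) (Fin (2^n)) ℂ)
    (hrel : ∀ a b, c a * c b + c b * c a = if a = b then 2 else 0)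
    (hherm : ∀ a, (c a)ᴴ = c a)
    (ω : Matrix (Fin (2^n)) (Fin (2^n)) ℂ →ₗ[ℂ] GA (Fin (2*n)))
    (hω : ∀ S : Finset (Fin (2*n)),
      ω ((S.sort (· ≤ ·) |>.map c).prod) = (S.sort (· ≤ ·) |>.map θv).prod)
    (M : Matrix (Fin (2*n)) (Fin (2*n)) ℝ) (hM : Mᵀ = -M)
    (hMI : (1 - Mᵀ * M).PosSemidef)
    (ρ : Matrix (Fin (2^n)) (Fin (2^n)) ℂ)
    (hρ : ω ρ = ((2:ℂ)^n)⁻¹ •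
      gexp (2*n+1) ((Complex.I / 2) • quadform (M.map Complex.ofReal))) :
    ((ρ * ((2:ℂ)⁻¹ • (1 + Complex.I •
        (c ⟨0, by omega⟩ * c ⟨1, by omega⟩)))).trace) ^ 2
      = (1/4 : ℂ) * Complex.ofReal ((M * Kmat n - 1).det) := by
  have hpq : (⟨0, by omega⟩ : Fin (2*n)) < ⟨1, by omega⟩ := by simp [Fin.lt_def]
  rw [det_K M hM ⟨0, by omega⟩ ⟨1, by omega⟩ rfl rfl]
  have hMqp : M ⟨1, by omega⟩ ⟨0, by omega⟩ = - M ⟨0, by omega⟩ ⟨1, by omega⟩ := by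
    have := congrFun (congrFun hM ⟨0, by omega⟩) ⟨1, by omega⟩
    simpa using this
  generalize (⟨0, by omega⟩ : Fin (2*n)) = p at *
  generalize (⟨1, by omega⟩ : Fin (2*n)) = q at *
  have key1 : Matrix.traceLinearMap (Fin (2^n)) ℂ ℂ
      = (2 ^ n : ℂ) • ((eps (2*n)).toLinearMap ∘ₗ ω) := by
    apply LinearMap.ext_on_range (aux_span c hrel)
    intro S
    have h := aux_orth c hrel S ∅
    simp only [Finset.sort_empty, List.reverse_nil, List.map_nil, List.prod_nil, one_mul] at h
    have he : (S.sort (· ≤ ·)) = [] ↔ S = ∅ := by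
      rw [← List.length_eq_zero_iff, Finset.length_sort, Finset.card_eq_zero]
    simp only [Matrix.traceLinearMap_apply, h, LinearMap.smul_apply, LinearMap.comp_apply, hω,
      AlgHom.toLinearMap_apply, eps_sort, he]
    simp
  have key2 : Matrix.traceLinearMap (Fin (2^n)) ℂ ℂ ∘ₗ LinearMap.mulLeft ℂ (c q * c p)
      = (2 ^ n : ℂ) • (dd p q ∘ₗ ω) := by
    apply LinearMap.ext_on_range (aux_span c hrel)
    intro S
    have h := aux_orth c hrel S {p, q}
    have hsort : ({p, q} : Finset (Fin (2*n))).sort (· ≤ ·) = [p, q] := by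
      rw [Finset.sort_insert]
      · simp
      · simpa using hpq.le
      · simpa using hpq.ne
    rw [hsort] at h
    simp only [List.reverse_cons, List.reverse_nil, List.nil_append, List.cons_append, List.map_cons,
      List.map_nil, List.prod_cons, List.prod_nil, mul_one] at h
    simp only [LinearMap.smul_apply, LinearMap.comp_apply, hω, dd_sort p q hpq,
      Matrix.traceLinearMap_apply, LinearMap.mulLeft_apply, h]
    simp
  have t1 := LinearMap.congr_fun key1 ρ
  have t2 := LinearMap.congr_fun key2 ρ
  have h2n : (2:ℂ)^n ≠ 0 := pow_ne_zero _ two_ne_zero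
  obtain ⟨k, hk⟩ : ∃ k, 2 * n + 1 = k + 2 := ⟨2 * n - 1, by omega⟩
  simp only [LinearMap.smul_apply, LinearMap.comp_apply, hρ, AlgHom.toLinearMap_apply, map_smul,
    eps_gexp, Matrix.traceLinearMap_apply, smul_eq_mul, mul_one, mul_inv_cancel₀ h2n] at t1
  simp only [LinearMap.smul_apply, LinearMap.comp_apply, hρ, map_smul, hk,
    dd_gexp, Matrix.traceLinearMap_apply, smul_eq_mul, mul_inv_cancel_left₀ h2n,
    LinearMap.mulLeft_apply, Matrix.map_apply, hMqp] at t2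
  have hanti : c p * c q = -(c q * c p) := by
    have := hrel p q
    rw [if_neg hpq.ne] at this
    exact eq_neg_of_add_eq_zero_left this
  rw [Matrix.mul_smul, Matrix.trace_smul, mul_add, mul_one, Matrix.trace_add, t1, Matrix.mul_smul,
    Matrix.trace_smul, Matrix.trace_mul_comm, hanti, neg_mul, Matrix.trace_neg, t2]
  have hI := Complex.I_mul_I
  push_cast
  simp only [smul_eq_mul]
  have : (Complex.I * -(Complex.I / 2 * ((M p q : ℂ) - -(M p q : ℂ)))) = M p q := by
    linear_combination (-(M p q : ℂ)) * hI
  rw [this]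
  ring
end

section
/- An even element X of the Clifford algebra C_{2n} whose Grassmann representation is a Gaussian exponential C exp((i/2)θᵀMθ) with C ≠ 0 and M complex antisymmetric, satisfies [Λ, X ⊗ X] = 0 for Λ = ∑_a c_a ⊗ c_a. -/
open scoped BigOperators Kronecker
open Matrix

namespace GaussLam
open CliffordAlgebra

variable {N : ℕ}

/-- minus the dot product -/
noncomputable def Bm (N : ℕ) : LinearMap.BilinForm ℂ (Fin N → ℂ) :=
  LinearMap.mk₂ ℂ (fun x y => -∑ a, x a * y a)
    (by intros; simp [add_mul, Finset.sum_add_distrib]; ring)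
    (by intros; simp [Finset.mul_sum, mul_assoc])
    (by intros; simp [mul_add, Finset.sum_add_distrib]; ring)
    (by intros; simp [Finset.mul_sum, mul_left_comm])

noncomputable def QQ (N : ℕ) : QuadraticForm ℂ (Fin N → ℂ) := -(Bm N).toQuadraticMap

lemma Bm_single (a : Fin N) : Bm N (Pi.single a 1) = -(LinearMap.proj a) := by
  ext i
  simp [Bm, Pi.single_apply, eq_comm]

lemma hQ : (Bm N).toQuadraticMap = 0 - QQ N := by simp [QQ]

/-- symbol map -/
noncomputable def e (N : ℕ) : CliffordAlgebra (QQ N) ≃ₗ[ℂ] GA (Fin N) := changeFormEquiv hQ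

/-- Clifford generator -/
noncomputable def g (a : Fin N) : CliffordAlgebra (QQ N) := ι (QQ N) (Pi.single a 1)

lemma e_one : e N 1 = 1 := changeForm_one hQ

lemma e_g_mul (a : Fin N) (y) : e N (g a * y) = θv a * e N y + pderiv _ a (e N y) := by
  have := changeForm_ι_mul (hQ (N := N)) (Pi.single a 1) y
  rw [Bm_single, map_neg, LinearMap.neg_apply, sub_neg_eq_add] at this
  exact this

lemma pderiv_θ_mul (a b : Fin N) (y : GA (Fin N)) :
    pderiv _ a (θv b * y) = (if a = b then (1:ℂ) else 0) • y - θv b * pderiv _ a y := by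
  have := contractLeft_ι_mul (Q := (0 : QuadraticForm ℂ (Fin N → ℂ))) (LinearMap.proj a)
    (Pi.single b 1) y
  rw [LinearMap.proj_apply, Pi.single_apply] at this
  exact this

lemma pderiv_one (a : Fin N) : pderiv _ a (1 : GA (Fin N)) = 0 := contractLeft_one _ _

lemma pderiv_list (a : Fin N) (l : List (Fin N)) (h : a ∉ l) :
    pderiv _ a (l.map θv).prod = 0 := by
  induction l with
  | nil => simp [pderiv_one]
  | cons b l ih =>
    simp only [List.mem_cons, not_or] at h
    rw [List.map_cons, List.prod_cons, pderiv_θ_mul, ih h.2]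
    simp [h.1]

lemma e_list (l : List (Fin N)) (h : l.Nodup) : e N (l.map g).prod = (l.map θv).prod := by
  induction l with
  | nil => simp [e_one]
  | cons b l ih =>
    rw [List.nodup_cons] at h
    rw [List.map_cons, List.prod_cons, e_g_mul, ih h.2, pderiv_list _ _ h.1]
    simp

noncomputable def bE (N : ℕ) : Module.Basis (Finset (Fin N)) ℂ (GA (Fin N)) :=
  (Pi.basisFun ℂ (Fin N)).ExteriorAlgebra

lemma bE_apply (S : Finset (Fin N)) : bE N S = ((S.sort (· ≤ ·)).map θv).prod := by
  rw [bE, ExteriorAlgebra.basis_apply_ofCard _ rfl]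
  simp only [ExteriorAlgebra.ιMulti_family, ExteriorAlgebra.ιMulti_apply]
  congr 1
  apply List.ext_getElem
  · simp
  · intro i h1 h2
    simp [θv, Set.powersetCard.ofFinEmbEquiv_symm_apply, Finset.orderEmbOfFin_apply]

lemma involute_contract {Q : QuadraticForm ℂ (Fin N → ℂ)} (d : Module.Dual ℂ (Fin N → ℂ))
    (y : CliffordAlgebra Q) : involute (contractLeft d y) = -contractLeft d (involute y) := by
  induction y using CliffordAlgebra.left_induction with
  | algebraMap r => simp [AlgHom.commutes]
  | add x y hx hy => simp only [map_add, hx, hy]; abel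
  | ι_mul x m hx =>
    rw [contractLeft_ι_mul, map_sub, map_smul, map_mul, map_mul, involute_ι, hx, neg_mul,
      neg_mul, map_neg, contractLeft_ι_mul]
    simp

lemma involute_e (y) : involute (Q := (0 : QuadraticForm ℂ (Fin N → ℂ))) (e N y)
    = e N (involute y) := by
  change involute (changeForm hQ y) = changeForm hQ (involute y)
  induction y using CliffordAlgebra.left_induction with
  | algebraMap r => simp [AlgHom.commutes]
  | add x y hx hy => simp only [map_add, hx, hy]
  | ι_mul x m hx =>
    rw [changeForm_ι_mul, map_sub, map_mul, involute_contract, hx, map_mul, involute_ι, involute_ι,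
      neg_mul, neg_mul, map_neg, changeForm_ι_mul]
    abel

lemma g_anti (a : Fin N) (m : Fin N → ℂ) :
    g a * ι (QQ N) m = algebraMap ℂ _ (2 * m a) - ι (QQ N) m * g a := by
  have h := ι_mul_ι_add_swap (Q := QQ N) (Pi.single a 1) m
  have h2 : QuadraticMap.polar (QQ N) (Pi.single a 1) m = 2 * m a := by
    simp only [QuadraticMap.polar, QQ, Bm]
    simp [add_mul, mul_add, Finset.sum_add_distrib, Pi.single_apply]
    ring
  rw [h2] at h
  rw [← h, g]
  abel

/-- `g_a y - involute(y) g_a = 2 ∂_a y`. -/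
lemma comm_g (a : Fin N) (y : CliffordAlgebra (QQ N)) :
    g a * y - involute y * g a = (2:ℂ) • contractLeft (LinearMap.proj a) y := by
  induction y using CliffordAlgebra.left_induction with
  | algebraMap r => simp [AlgHom.commutes, Algebra.commutes]
  | add x y hx hy =>
    rw [map_add, map_add, smul_add, ← hx, ← hy, mul_add, add_mul]; abel
  | ι_mul x m hx =>
    rw [contractLeft_ι_mul, smul_sub, ← mul_smul_comm, ← hx, map_mul, involute_ι, ← mul_assoc,
      g_anti, sub_mul, ← Algebra.smul_def, smul_smul, mul_sub, LinearMap.proj_apply]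
    noncomm_ring

lemma e_contract (a : Fin N) (y : CliffordAlgebra (QQ N)) :
    e N (contractLeft (LinearMap.proj a) y) = pderiv _ a (e N y) :=
  changeForm_contractLeft hQ _ _


/-! ### Gaussian derivative -/

lemma θ_anti (a b : Fin N) : (θv a * θv b : GA (Fin N)) = - (θv b * θv a) :=
  eq_neg_of_add_eq_zero_left (ExteriorAlgebra.ι_add_mul_swap _ _)

lemma θ_comm_q (M : Matrix (Fin N) (Fin N) ℂ) (c : Fin N) :
    Commute (θv c) (quadform M) := by
  unfold quadform
  refine Commute.sum_right _ _ _ fun a _ => Commute.sum_right _ _ _ fun b _ => ?_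
  refine Commute.smul_right ?_ _
  change _ * _ = _ * _
  rw [← mul_assoc, θ_anti c a, neg_mul, mul_assoc, θ_anti c b, mul_neg, neg_neg, mul_assoc]

/-- `v_a = ∑_b i M_{ab} θ_b` -/
noncomputable def vv (M : Matrix (Fin N) (Fin N) ℂ) (a : Fin N) : GA (Fin N) :=
  ∑ b, (Complex.I * M a b) • θv b

lemma pderiv_q_mul (M : Matrix (Fin N) (Fin N) ℂ) (hM : Mᵀ = -M) (a : Fin N) (y : GA (Fin N)) :
    pderiv _ a (((Complex.I / 2) • quadform M) * y)
      = vv M a * y + ((Complex.I / 2) • quadform M) * pderiv _ a y := by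
  have h1 : ∀ b c, pderiv _ a (θv b * θv c * y) = (if a = b then (1:ℂ) else 0) • (θv c * y)
      - (if a = c then (1:ℂ) else 0) • (θv b * y) + θv b * θv c * pderiv _ a y := by
    intro b c
    rw [mul_assoc, pderiv_θ_mul, pderiv_θ_mul, mul_sub, mul_smul_comm, mul_assoc]
    abel
  have hM' : ∀ b, M b a = - M a b := fun b => by
    have := congrFun (congrFun hM a) b
    simpa using this
  have h2 : pderiv _ a (quadform M * y) = (2:ℂ) • (∑ b, M a b • (θv b * y))
      + quadform M * pderiv _ a y := by
    simp only [quadform, Finset.sum_mul, map_sum, smul_mul_assoc, map_smul, h1, smul_add, smul_sub,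
      Finset.sum_add_distrib, Finset.sum_sub_distrib, smul_smul]
    congr 1
    rw [Finset.sum_comm (f := fun x y_1 => (M x y_1 * if a = x then (1:ℂ) else 0) • (θv y_1 * y))]
    simp only [mul_ite, mul_one, mul_zero, ite_smul, zero_smul, Finset.sum_ite_eq,
      Finset.mem_univ, if_true, hM', neg_smul, Finset.sum_neg_distrib, two_smul, sub_neg_eq_add]
  rw [smul_mul_assoc, map_smul, h2, smul_add, smul_smul, smul_mul_assoc]
  congr 1
  simp only [vv, Finset.sum_mul, Finset.smul_sum, smul_smul, smul_mul_assoc]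
  refine Finset.sum_congr rfl fun b _ => ?_
  congr 1
  ring

lemma q_pow (M : Matrix (Fin N) (Fin N) ℂ) (hN : 0 < N) :
    ((Complex.I / 2) • quadform M) ^ N = 0 := by
  have hq : ((Complex.I / 2) • quadform M) ∈ ⋀[ℂ]^2 (Fin N → ℂ) := by
    refine Submodule.smul_mem _ _ (Submodule.sum_mem _ fun a _ => Submodule.sum_mem _ fun b _ =>
      Submodule.smul_mem _ _ ?_)
    rw [ExteriorAlgebra.exteriorPower, pow_two]
    exact Submodule.mul_mem_mul ⟨_, rfl⟩ ⟨_, rfl⟩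
  have h2 := SetLike.pow_mem_graded (A := fun i : ℕ => ⋀[ℂ]^i (Fin N → ℂ)) N hq
  have h3 : Module.finrank ℂ (⋀[ℂ]^(N • 2) (Fin N → ℂ)) = 0 := by
    rw [exteriorPower.finrank_eq]
    apply Nat.choose_eq_zero_of_lt
    simp; omega
  have h4 := Submodule.finrank_eq_zero.mp h3
  rw [h4] at h2
  exact (Submodule.mem_bot _).mp h2

lemma pderiv_q_pow (M : Matrix (Fin N) (Fin N) ℂ) (hM : Mᵀ = -M) (a : Fin N) (k : ℕ) :
    pderiv _ a (((Complex.I / 2) • quadform M) ^ (k+1))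
      = ((k+1 : ℕ) : ℂ) • (vv M a * ((Complex.I / 2) • quadform M) ^ k) := by
  have hc : Commute (vv M a) ((Complex.I / 2) • quadform M) :=
    Commute.sum_left _ _ _ fun b _ => ((θ_comm_q M b).smul_left _).smul_right _
  induction k with
  | zero =>
    have := pderiv_q_mul M hM a 1
    simpa [pderiv_one] using this
  | succ k ih =>
    rw [pow_succ', pderiv_q_mul M hM, ih, mul_smul_comm, ← mul_assoc, ← hc.eq, mul_assoc, ← pow_succ']
    push_cast
    module

lemma pderiv_gexp (M : Matrix (Fin N) (Fin N) ℂ) (hM : Mᵀ = -M) (a : Fin N) :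
    pderiv _ a (gexp (N+1) ((Complex.I / 2) • quadform M))
      = vv M a * gexp (N+1) ((Complex.I / 2) • quadform M) := by
  have hN : 0 < N := a.pos
  unfold gexp
  rw [map_sum, Finset.sum_range_succ', Finset.sum_range_succ, q_pow M hN]
  simp only [smul_zero, add_zero, pow_zero, map_smul, pderiv_one, Finset.mul_sum]
  refine Finset.sum_congr rfl fun k _ => ?_
  rw [pderiv_q_pow M hM, smul_smul, mul_smul_comm]
  congr 1
  rw [Nat.factorial_succ, Nat.cast_mul]
  have : ((k+1 : ℕ) : ℂ) ≠ 0 := Nat.cast_ne_zero.mpr (Nat.succ_ne_zero k)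
  have : (k.factorial : ℂ) ≠ 0 := Nat.cast_ne_zero.mpr (Nat.factorial_ne_zero k)
  field_simp

/-! ### The representation -/

noncomputable def cl {A : Type*} [Ring A] [Algebra ℂ A] (c : Fin N → A) : (Fin N → ℂ) →ₗ[ℂ] A :=
  Fintype.linearCombination ℂ c

lemma cl_sq {A : Type*} [Ring A] [Algebra ℂ A] (c : Fin N → A)
    (hrel : ∀ a b, c a * c b + c b * c a = if a = b then 2 else 0) (x : Fin N → ℂ) :
    cl c x * cl c x = algebraMap ℂ A (QQ N x) := by
  have h1 : cl c x * cl c x = ∑ a, ∑ b, (x a * x b) • (c a * c b) := by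
    simp only [cl, Fintype.linearCombination_apply, Finset.sum_mul_sum, smul_mul_smul_comm]
  have h2 : cl c x * cl c x = ∑ a, ∑ b, (x a * x b) • (c b * c a) := by
    rw [h1, Finset.sum_comm]
    refine Finset.sum_congr rfl fun b _ => Finset.sum_congr rfl fun a _ => ?_
    rw [mul_comm]
  have h3 : (2:ℂ) • (cl c x * cl c x) = (2:ℂ) • algebraMap ℂ A (QQ N x) := by
    rw [two_smul]
    nth_rewrite 1 [h1]
    rw [h2]
    simp only [← Finset.sum_add_distrib, ← smul_add, hrel]
    simp only [smul_ite, smul_zero, Finset.sum_ite_eq, Finset.mem_univ, if_true]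
    rw [← Finset.sum_smul]
    have : QQ N x = ∑ a, x a * x a := by simp [QQ, Bm]
    rw [this, Algebra.algebraMap_eq_smul_one, smul_comm, two_smul, one_add_one_eq_two]
  exact smul_right_injective A (two_ne_zero' ℂ) h3

noncomputable def φ {A : Type*} [Ring A] [Algebra ℂ A] (c : Fin N → A)
    (hrel : ∀ a b, c a * c b + c b * c a = if a = b then 2 else 0) :
    CliffordAlgebra (QQ N) →ₐ[ℂ] A := CliffordAlgebra.lift (QQ N) ⟨cl c, cl_sq c hrel⟩

lemma φ_g {A : Type*} [Ring A] [Algebra ℂ A] (c : Fin N → A)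
    (hrel : ∀ a b, c a * c b + c b * c a = if a = b then 2 else 0) (a : Fin N) :
    φ c hrel (g a) = c a := by
  simp [φ, g, cl, Fintype.linearCombination_apply_single]

lemma ω_φ {A : Type*} [Ring A] [Algebra ℂ A] (c : Fin N → A)
    (hrel : ∀ a b, c a * c b + c b * c a = if a = b then 2 else 0)
    (ω : A →ₗ[ℂ] GA (Fin N))
    (hω : ∀ S : Finset (Fin N),
      ω ((S.sort (· ≤ ·) |>.map c).prod) = (S.sort (· ≤ ·) |>.map θv).prod) (y) :
    ω (φ c hrel y) = e N y := by
  have : ω ∘ₗ (φ c hrel).toLinearMap = (e N).toLinearMap := by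
    refine ((bE N).map (e N).symm).ext fun S => ?_
    have h : ((bE N).map (e N).symm) S = ((S.sort (· ≤ ·)).map g).prod := by
      rw [Module.Basis.map_apply, LinearEquiv.symm_apply_eq, e_list _ (Finset.sort_nodup ..),
        bE_apply]
    rw [h]
    simp only [LinearMap.comp_apply, AlgHom.toLinearMap_apply, LinearEquiv.coe_coe]
    rw [e_list _ (Finset.sort_nodup ..), map_list_prod, List.map_map, ← hω]
    congr 3
    ext a
    simp [φ_g]
  exact LinearMap.congr_fun this y

lemma kron_alg {m : ℕ} (P D : Fin N → Matrix (Fin m) (Fin m) ℂ) (K : Matrix (Fin N) (Fin N) ℂ)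
    (hK : ∀ a b, K b a = - K a b) (hD : ∀ a, D a = ∑ b, K a b • P b) :
    ∑ a, (P a + D a) ⊗ₖ (P a + D a) = ∑ a, (P a - D a) ⊗ₖ (P a - D a) := by
  have h : ∑ a, (P a ⊗ₖ D a + D a ⊗ₖ P a) = 0 := by
    ext ⟨i, i'⟩ ⟨j, j'⟩
    simp only [hD, Matrix.sum_apply, Matrix.add_apply, kroneckerMap_apply, Matrix.smul_apply,
      smul_eq_mul, Matrix.zero_apply, Finset.sum_add_distrib, Finset.mul_sum, Finset.sum_mul]
    rw [Finset.sum_comm, ← Finset.sum_add_distrib]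
    refine Finset.sum_eq_zero fun a _ => ?_
    rw [← Finset.sum_add_distrib]
    refine Finset.sum_eq_zero fun b _ => ?_
    rw [hK]
    ring
  have h2 : ∀ a, (P a + D a) ⊗ₖ (P a + D a) - (P a - D a) ⊗ₖ (P a - D a)
      = (2:ℂ) • (P a ⊗ₖ D a + D a ⊗ₖ P a) := by
    intro a
    ext ⟨i, i'⟩ ⟨j, j'⟩
    simp
    ring
  rw [← sub_eq_zero, ← Finset.sum_sub_distrib, Finset.sum_congr rfl fun a _ => h2 a,
    ← Finset.smul_sum, h, smul_zero]

end GaussLam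

/-- An even element `X` of the Clifford algebra (realized by matrices on
`ℂ^{2ⁿ}`) whose Grassmann representation is a Gaussian exponential `C exp((i/2)θᵀMθ)`
with `C ≠ 0` and `M` complex antisymmetric satisfies `[Λ, X ⊗ X] = 0` for
`Λ = ∑_a c_a ⊗ c_a`. -/
theorem gaussian_operator_commutes_with_lambda {n : ℕ}
    (c : Fin (2*n) → Matrix (Fin (2^n)) (Fin (2^n)) ℂ)
    (hrel : ∀ a b, c a * c b + c b * c a = if a = b then 2 else 0)
    (ω : Matrix (Fin (2^n)) (Fin (2^n)) ℂ →ₗ[ℂ] GA (Fin (2*n)))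
    (hω : ∀ S : Finset (Fin (2*n)),
      ω ((S.sort (· ≤ ·) |>.map c).prod) = (S.sort (· ≤ ·) |>.map θv).prod)
    (X : Matrix (Fin (2^n)) (Fin (2^n)) ℂ)
    (heven : ω X ∈ CliffordAlgebra.evenOdd (0 : QuadraticForm ℂ (Fin (2*n) → ℂ)) 0)
    (C : ℂ) (hC : C ≠ 0) (M : Matrix (Fin (2*n)) (Fin (2*n)) ℂ) (hM : Mᵀ = -M)
    (hX : ω X = C • gexp (2*n+1) ((Complex.I / 2) • quadform M)) :
    (∑ a, c a ⊗ₖ c a) * (X ⊗ₖ X) = (X ⊗ₖ X) * (∑ a, c a ⊗ₖ c a) := by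
  have hsurj : Function.Surjective ω := fun z =>
    ⟨GaussLam.φ c hrel ((GaussLam.e (2*n)).symm z), by rw [GaussLam.ω_φ c hrel ω hω]; simp⟩
  have hfin : Module.Finite ℂ (GA (Fin (2*n))) := Module.Finite.of_basis (GaussLam.bE (2*n))
  have hrank : Module.finrank ℂ (Matrix (Fin (2^n)) (Fin (2^n)) ℂ)
      = Module.finrank ℂ (GA (Fin (2*n))) := by
    rw [Module.finrank_eq_card_basis (GaussLam.bE (2*n)), Module.finrank_matrix]
    simp
    ring
  have hinj : Function.Injective ω :=
    (LinearMap.injective_iff_surjective_of_finrank_eq_finrank hrank).mpr hsurj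
  set φ := GaussLam.φ c hrel with hφ
  have hωφ : ∀ y, ω (φ y) = GaussLam.e (2*n) y := GaussLam.ω_φ c hrel ω hω
  set y := (GaussLam.e (2*n)).symm (ω X) with hy
  have hey : GaussLam.e (2*n) y = ω X := by simp [hy]
  have hXy : φ y = X := hinj (by rw [hωφ, hey])
  have hinv : CliffordAlgebra.involute y = y := by
    apply (GaussLam.e (2*n)).injective
    rw [← GaussLam.involute_e, hey]
    exact CliffordAlgebra.involute_eq_of_mem_even heven
  let D : Fin (2*n) → Matrix (Fin (2^n)) (Fin (2^n)) ℂ := fun a =>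
    φ (CliffordAlgebra.contractLeft (LinearMap.proj a) y)
  let P : Fin (2*n) → Matrix (Fin (2^n)) (Fin (2^n)) ℂ := fun a => c a * X - D a
  have hL : ∀ a, c a * X = P a + D a := fun a => by simp [P]
  have hR : ∀ a, X * c a = P a - D a := fun a => by
    have h := congrArg φ (GaussLam.comm_g a y)
    rw [hinv, map_sub, map_mul, map_mul, hXy, hφ, GaussLam.φ_g, map_smul, two_smul] at h
    change _ = D a + D a at h
    simp only [P]
    rw [sub_sub, ← h]
    abel
  have hωD : ∀ a, ω (D a) = pderiv _ a (ω X) := fun a => by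
    simp only [D]
    rw [hωφ, GaussLam.e_contract, hey]
  have hωP : ∀ a, ω (P a) = θv a * ω X := fun a => by
    have h : c a * X = φ (GaussLam.g a * y) := by rw [map_mul, hXy, hφ, GaussLam.φ_g]
    simp only [P]
    rw [map_sub, hωD, h, hωφ, GaussLam.e_g_mul, hey, add_sub_cancel_right]
  have hD : ∀ a, D a = ∑ b, (Complex.I • M) a b • P b := fun a => by
    apply hinj
    rw [hωD, map_sum]
    simp only [map_smul, hωP]
    rw [hX, map_smul, GaussLam.pderiv_gexp M hM, GaussLam.vv, Finset.sum_mul, Finset.smul_sum]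
    refine Finset.sum_congr rfl fun b _ => ?_
    rw [mul_smul_comm, smul_mul_assoc, smul_comm]
    simp
  have hK : ∀ a b, (Complex.I • M) b a = -(Complex.I • M) a b := fun a b => by
    have := congrFun (congrFun hM a) b
    simp only [Matrix.transpose_apply, Matrix.neg_apply] at this
    simp [this]
  rw [Finset.sum_mul, Finset.mul_sum]
  simp only [← Matrix.mul_kronecker_mul, hL, hR]
  exact GaussLam.kron_alg P D _ hK hD
end
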